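/- arXiv:math/0509668 — 3 statements merged into one kernel-verified Lean document; each statement's English description precedes it below -/
import Mathlib

section
/- Let h : [0,∞) → [0,∞) be continuous, nondecreasing, with h(x) → ∞ as x → ∞ and h(x) ≤ (1+x)^{1/4} for all x ≥ 0. Let k > 0 and θ₀ ∈ ℝ. Then there exist a differentiable function θ : [0,∞) → ℝ and a continuous potential V : [0,∞) → ℝ such that: (i) V(x) = −(h(x)/(2(1+x)))·sin(2θ(x)) for all x ≥ 0 (in particular |V(x)| ≤ h(x)/(1+x)); (ii) θ(0) = θ₀ and θ'(x) = k − (1/k)·V(x)·sin²θ(x) for all x ≥ 0; and (iii) the function u(x) := exp((1/(2k))·∫₀ˣ V(y)·sin(2θ(y)) dy)·sin θ(x) is a twice continuously differentiable solution of −u'' + V u = k²u on [0,∞) that is square integrable: ∫₀^∞ |u(x)|² dx < ∞. -/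
open Real Set MeasureTheory

lemma global_ode (f : ℝ → ℝ → ℝ) (K L : NNReal) (x₀ : ℝ)
    (hL : ∀ t, LipschitzWith K (f t)) (hc : ∀ x, Continuous (fun t => f t x))
    (hb : ∀ t x, ‖f t x‖ ≤ L) :
    ∃ α : ℝ → ℝ, α 0 = x₀ ∧ ∀ t, HasDerivAt α (f t (α t)) t := by
  have key : ∀ n : ℕ, ∃ α : ℝ → ℝ, α 0 = x₀ ∧
      ∀ t ∈ Ioo (-((n:ℝ)+1)) ((n:ℝ)+1), HasDerivAt α (f t (α t)) t := by
    intro n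
    have h0 : (0:ℝ) ∈ Icc (-((n:ℝ)+1)) ((n:ℝ)+1) := by
      constructor <;> linarith [(Nat.cast_nonneg n : (0:ℝ) ≤ n)]
    have hp : IsPicardLindelof f (⟨0, h0⟩ : Icc (-((n:ℝ)+1)) ((n:ℝ)+1)) x₀
        (L * ((n:NNReal)+1)) 0 L K :=
      { lipschitzOnWith := fun t _ => (hL t).lipschitzOnWith
        continuousOn := fun x _ => (hc x).continuousOn
        norm_le := fun t _ x _ => hb t x
        mul_max_le := by simp }
    obtain ⟨α, h1, h2⟩ := hp.exists_eq_forall_mem_Icc_hasDerivWithinAt₀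
    exact ⟨α, h1, fun t ht => (h2 t (Ioo_subset_Icc_self ht)).hasDerivAt (Icc_mem_nhds ht.1 ht.2)⟩
  choose α hα0 hα using key
  have uniq : ∀ m n : ℕ, ∀ t : ℝ, |t| < m + 1 → |t| < n + 1 → α m t = α n t := by
    intro m n t hm hn
    have hm' := abs_lt.1 hm
    have hn' := abs_lt.1 hn
    set c : ℝ := min ((m:ℝ)+1) (n+1) with hcdef
    have hcm : c ≤ m + 1 := min_le_left _ _
    have hcn : c ≤ n + 1 := min_le_right _ _
    have hc0 : 0 < c := lt_min (by positivity) (by positivity)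
    have htc : |t| < c := lt_min hm hn
    refine ODE_solution_unique_of_mem_Ioo (v := f) (s := fun _ => univ) (K := K) (t₀ := 0)
      (a := -c) (b := c) (fun t _ => (hL t).lipschitzOnWith) ⟨by linarith, hc0⟩ ?_ ?_ ?_
      (abs_lt.1 htc)
    · intro s hs
      exact ⟨hα m s ⟨by linarith [hs.1], by linarith [hs.2]⟩, mem_univ _⟩
    · intro s hs
      exact ⟨hα n s ⟨by linarith [hs.1], by linarith [hs.2]⟩, mem_univ _⟩
    · rw [hα0, hα0]
  refine ⟨fun t => α ⌈|t|⌉₊ t, hα0 _, fun t => ?_⟩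
  have hlt : ∀ s : ℝ, |s| < (⌈|s|⌉₊ : ℝ) + 1 := fun s => by
    linarith [Nat.le_ceil |s|]
  have h1 := hα ⌈|t|⌉₊ t (abs_lt.1 (hlt t))
  refine h1.congr_of_eventuallyEq ?_
  have : ∀ᶠ s in nhds t, |s| < (⌈|t|⌉₊ : ℝ) + 1 :=
    continuous_abs.continuousAt.eventually_lt continuousAt_const (hlt t)
  filter_upwards [this] with s hs
  exact uniq _ _ s (hlt s) hs

lemma prufer (g : ℝ → ℝ) (hg : Continuous g) (hg0 : ∀ x, 0 ≤ g x) (hg1 : ∀ x, g x ≤ 1)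
    (k θ₀ : ℝ) (hk : 0 < k) :
    ∃ θ : ℝ → ℝ, θ 0 = θ₀ ∧ ∀ t, HasDerivAt θ
      (k - (1/k) * (-(g t) * sin (2 * θ t)) * sin (θ t) ^ 2) t := by
  have habs : ∀ t, |g t| ≤ 1 := fun t => abs_le.2 ⟨by linarith [hg0 t], hg1 t⟩
  refine global_ode (fun t x => k - (1/k) * (-(g t) * sin (2 * x)) * sin x ^ 2)
    (Real.toNNReal (4/k)) (Real.toNNReal (k + 1/k)) θ₀ ?_ ?_ ?_
  · intro t
    have hd : ∀ x, HasDerivAt (fun x => k - (1/k) * (-(g t) * sin (2 * x)) * sin x ^ 2)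
        ((1/k) * (g t * (cos (2*x) * (2 * sin x ^2) + sin (2*x) * (2 * sin x * cos x)))) x := by
      intro x
      have h1 : HasDerivAt (fun x : ℝ => sin (2 * x)) (cos (2*x) * 2) x := by
        simpa using ((hasDerivAt_id x).const_mul 2).sin
      have h2 := (hasDerivAt_sin x).pow 2
      refine ((((h1.const_mul (-(g t))).const_mul (1/k)).mul h2).const_sub k).congr_deriv ?_
      simp only [Pi.pow_apply]
      push_cast
      ring
    refine lipschitzWith_of_nnnorm_deriv_le (fun x => (hd x).differentiableAt) ?_
    intro x
    rw [(hd x).deriv, ← NNReal.coe_le_coe, coe_nnnorm, Real.coe_toNNReal _ (by positivity),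
      norm_eq_abs, abs_mul, abs_mul, abs_of_pos (by positivity : (0:ℝ) < 1/k)]
    have e : |cos (2*x) * (2 * sin x ^2) + sin (2*x) * (2 * sin x * cos x)| ≤ 4 := by
      have a1 := abs_cos_le_one (2*x)
      have a2 := abs_sin_le_one (2*x)
      have a3 := abs_sin_le_one x
      have a4 := abs_cos_le_one x
      refine (abs_add_le _ _).trans ?_
      simp only [abs_mul, abs_pow, abs_two]
      have b1 : |cos (2*x)| * (2 * |sin x|^2) ≤ 1 * (2 * 1^2) := by gcongr
      have b2 : |sin (2*x)| * (2 * |sin x| * |cos x|) ≤ 1 * (2 * 1 * 1) := by gcongr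
      linarith
    calc 1/k * (|g t| * _) ≤ 1/k * (1 * 4) := by gcongr; exact habs t
      _ = 4/k := by ring
  · intro x
    fun_prop
  · intro t x
    rw [Real.coe_toNNReal _ (by positivity), norm_eq_abs]
    refine (abs_sub _ _).trans ?_
    simp only [abs_mul, abs_pow, abs_neg]
    rw [abs_of_pos hk, abs_of_pos (by positivity : (0:ℝ) < 1/k)]
    have : 1/k * (|g t| * |sin (2*x)|) * |sin x|^2 ≤ 1/k * (1*1) * 1^2 := by
      gcongr
      · exact habs t
      · exact abs_sin_le_one _
      · exact abs_sin_le_one _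
    linarith

lemma decay (L θ V g : ℝ → ℝ) (k x0 : ℝ) (hk : 0 < k) (hx0 : 0 ≤ x0)
    (hθ : ∀ x, HasDerivAt θ (k - (1/k) * V x * sin (θ x) ^ 2) x)
    (hL : ∀ x, HasDerivAt L (g x * sin (2 * θ x) ^ 2) x)
    (hg : ∀ x, x0 ≤ x → 4 * k / (1 + x) ≤ g x)
    (hV : ∀ x, 0 ≤ x → |V x| ≤ (1 + x) ^ (-(3/4) : ℝ)) :
    ∃ C, ∀ x, x0 ≤ x → 2 * k * log (1 + x) - C ≤ L x := by
  set K : ℝ := 1/(4*k) + 1/k^2 with hK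
  set Φ : ℝ → ℝ := fun x => L x - 2 * k * (log (1+x) - (1+x)⁻¹ * sin (4 * θ x) / (4*k))
    - 2 * k * K * (4/3) * (1+x) ^ (-(3/4) : ℝ) with hΦ
  set Φ' : ℝ → ℝ := fun x => g x * sin (2 * θ x) ^ 2
    - 2 * k * ((1+x)⁻¹ - (-((1+x)^2)⁻¹ * sin (4 * θ x)
      + (1+x)⁻¹ * (cos (4 * θ x) * (4 * (k - (1/k) * V x * sin (θ x) ^ 2)))) / (4*k))
    + 2 * k * K * (1+x) ^ (-(7/4) : ℝ) with hΦ'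
  have hder : ∀ x, x0 ≤ x → HasDerivAt Φ (Φ' x) x := by
    intro x hx
    have hp : 0 < 1 + x := by linarith
    have h1 : HasDerivAt (fun x : ℝ => 1 + x) 1 x := (hasDerivAt_id x).const_add 1
    have h2 := h1.log hp.ne'
    have h3 := h1.inv hp.ne'
    have h4 := ((hθ x).const_mul 4).sin
    have h5 := h1.rpow_const (p := (-(3/4) : ℝ)) (Or.inl hp.ne')
    refine (((hL x).sub ((h2.sub ((h3.mul h4).div_const (4*k))).const_mul (2*k))).sub
      (h5.const_mul (2 * k * K * (4/3)))).congr_deriv ?_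
    have : (-(3/4) - 1 : ℝ) = -(7/4) := by norm_num
    rw [this]
    simp only [hΦ', Pi.inv_apply, one_div, neg_div, div_eq_mul_inv]
    ring
  have hnn : ∀ x, x0 ≤ x → 0 ≤ Φ' x := by
    intro x hx
    have hp : 0 < 1 + x := by linarith
    have hw : 0 < (1+x)⁻¹ := by positivity
    have hc : cos (4 * θ x) = 1 - 2 * sin (2 * θ x) ^ 2 := by
      have : 4 * θ x = 2 * (2 * θ x) := by ring
      rw [this, cos_two_mul, cos_sq']; ring
    have e1 : ((1+x)^2)⁻¹ ≤ (1+x) ^ (-(7/4) : ℝ) := by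
      have : ((1+x)^2)⁻¹ = (1+x) ^ (-2 : ℝ) := by
        rw [rpow_neg hp.le]; norm_num
      rw [this]
      exact rpow_le_rpow_of_exponent_le (by linarith) (by norm_num)
    have e2 : (1+x)⁻¹ * |V x| ≤ (1+x) ^ (-(7/4) : ℝ) := by
      have : (1+x) ^ (-(7/4) : ℝ) = (1+x)⁻¹ * (1+x) ^ (-(3/4) : ℝ) := by
        rw [← rpow_neg_one, ← rpow_add hp]; norm_num
      rw [this]
      exact mul_le_mul_of_nonneg_left (hV x (by linarith)) hw.le
    have e3 : -((1+x) ^ (-(7/4) : ℝ)) ≤ ((1+x)^2)⁻¹ * (- sin (4 * θ x)) := by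
      have := neg_one_le_sin (4 * θ x)
      have := sin_le_one (4 * θ x)
      have : 0 ≤ ((1+x)^2)⁻¹ := by positivity
      nlinarith
    have e4 : -((1+x) ^ (-(7/4) : ℝ)) ≤ -((1+x)⁻¹ * V x * (cos (4 * θ x) * sin (θ x)^2)) := by
      refine neg_le_neg ((le_abs_self _).trans (le_trans ?_ e2))
      rw [abs_mul, abs_mul, abs_of_pos hw, abs_mul, abs_pow]
      have : |cos (4 * θ x)| * |sin (θ x)|^2 ≤ 1 * 1^2 := by
        gcongr
        · exact abs_cos_le_one _
        · exact abs_sin_le_one _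
      have h0 : 0 ≤ (1+x)⁻¹ * |V x| := by positivity
      nlinarith
    have e5 : 4 * k * (1+x)⁻¹ * sin (2 * θ x)^2 ≤ g x * sin (2 * θ x)^2 :=
      mul_le_mul_of_nonneg_right (hg x hx) (sq_nonneg _)
    have id : Φ' x = (g x * sin (2 * θ x)^2 - 4 * k * (1+x)⁻¹ * sin (2 * θ x)^2)
       + (1/2) * (((1+x)^2)⁻¹ * (- sin (4 * θ x)) + (1+x) ^ (-(7/4) : ℝ))
       + (2/k) * (-((1+x)⁻¹ * V x * (cos (4 * θ x) * sin (θ x)^2)) + (1+x) ^ (-(7/4) : ℝ)) := by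
      simp only [hΦ', hK, hc]
      generalize (1+x) ^ (-(7/4) : ℝ) = a
      generalize ((1+x)^2)⁻¹ = b
      generalize (1+x)⁻¹ = c
      field_simp
      ring
    rw [id]
    have : 0 ≤ (2/k) * (-((1+x)⁻¹ * V x * (cos (4 * θ x) * sin (θ x)^2)) + (1+x) ^ (-(7/4) : ℝ)) :=
      mul_nonneg (by positivity) (by linarith)
    linarith
  have hmono : MonotoneOn Φ (Ici x0) := by
    refine monotoneOn_of_hasDerivWithinAt_nonneg (f' := Φ') (convex_Ici x0)
      (fun y hy => (hder y hy).continuousAt.continuousWithinAt)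
      (fun y hy => (hder y (interior_subset hy)).hasDerivWithinAt)
      (fun y hy => hnn y (interior_subset hy))
  refine ⟨1/2 - Φ x0, fun x hx => ?_⟩
  have hp : 0 < 1 + x := by linarith
  have h1 : Φ x0 ≤ Φ x := hmono (le_refl x0) hx hx
  have h2 : 0 ≤ 2 * k * K * (4/3) * (1+x) ^ (-(3/4) : ℝ) := by positivity
  have h3 : (1+x)⁻¹ * sin (4 * θ x) ≤ 1 := by
    have : (1+x)⁻¹ ≤ 1 := inv_le_one_of_one_le₀ (by linarith)
    have h0 : 0 < (1+x)⁻¹ := by positivity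
    nlinarith [sin_le_one (4 * θ x)]
  have h4 : Φ x = L x - 2 * k * log (1+x) + (1/2) * ((1+x)⁻¹ * sin (4 * θ x))
      - 2 * k * K * (4/3) * (1+x) ^ (-(3/4) : ℝ) := by
    simp only [hΦ]
    generalize (1+x)⁻¹ = c
    field_simp
    ring
  linarith

theorem resonant_building_block
    (h : ℝ → ℝ) (hcont : ContinuousOn h (Ici (0 : ℝ)))
    (hnonneg : ∀ x ∈ Ici (0 : ℝ), 0 ≤ h x)
    (hmono : MonotoneOn h (Ici (0 : ℝ)))
    (hinf : Filter.Tendsto h Filter.atTop Filter.atTop)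
    (hbd : ∀ x ∈ Ici (0 : ℝ), h x ≤ (1 + x) ^ ((1 : ℝ) / 4))
    (k θ₀ : ℝ) (hk : 0 < k) :
    ∃ θ V : ℝ → ℝ,
      ContinuousOn V (Ici (0 : ℝ)) ∧
      (∀ x ∈ Ici (0 : ℝ), V x = -(h x / (2 * (1 + x))) * Real.sin (2 * θ x)) ∧
      (∀ x ∈ Ici (0 : ℝ), |V x| ≤ h x / (1 + x)) ∧
      θ 0 = θ₀ ∧
      (∀ x ∈ Ici (0 : ℝ),
        HasDerivAt θ (k - (1 / k) * V x * Real.sin (θ x) ^ 2) x) ∧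
      (∀ u : ℝ → ℝ,
        (∀ x, u x =
          Real.exp ((1 / (2 * k)) * ∫ y in (0:ℝ)..x, V y * Real.sin (2 * θ y)) *
            Real.sin (θ x)) →
        (∃ u' u'' : ℝ → ℝ,
          (∀ x ∈ Ici (0 : ℝ), HasDerivAt u (u' x) x) ∧
          (∀ x ∈ Ici (0 : ℝ), HasDerivAt u' (u'' x) x) ∧
          ContinuousOn u'' (Ici (0 : ℝ)) ∧
          (∀ x ∈ Ici (0 : ℝ), -u'' x + V x * u x = k ^ 2 * u x)) ∧
        IntegrableOn (fun x => u x ^ 2) (Ici (0 : ℝ))) := by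
  set g : ℝ → ℝ := fun x => h (max x 0) / (2 * (1 + max x 0)) with hg
  have hgc : Continuous g := by
    have h1 : Continuous (fun x : ℝ => h (max x 0)) :=
      hcont.comp_continuous (by fun_prop) (fun x => le_max_right x 0)
    refine h1.div (by fun_prop) (fun x => ?_)
    have : 0 ≤ max x 0 := le_max_right _ _
    positivity
  have hg0 : ∀ x, 0 ≤ g x := fun x => by
    have h0 : 0 ≤ max x 0 := le_max_right _ _
    have := hnonneg _ h0
    simp only [hg]
    positivity
  have hrp : ∀ x : ℝ, 0 ≤ x → h x / (1 + x) ≤ (1 + x) ^ (-(3/4) : ℝ) := by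
    intro x hx
    have hp : 0 < 1 + x := by linarith
    have e : (1+x) ^ (-(3/4) : ℝ) = (1+x) ^ ((1:ℝ)/4) / (1 + x) := by
      rw [← rpow_sub_one hp.ne']; norm_num
    rw [e]
    exact div_le_div_of_nonneg_right (hbd x hx) hp.le
  have hge : ∀ x, 0 ≤ x → g x = h x / (2 * (1 + x)) := fun x hx => by
    simp only [hg, max_eq_left hx]
  have hhalf : ∀ x : ℝ, 0 ≤ x → h x / (2 * (1 + x)) ≤ h x / (1 + x) := by
    intro x hx
    exact div_le_div_of_nonneg_left (hnonneg x hx) (by linarith) (by linarith)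
  have hg1 : ∀ x, g x ≤ 1 := fun x => by
    have h0 : 0 ≤ max x 0 := le_max_right _ _
    exact (hhalf _ h0).trans ((hrp _ h0).trans
      (rpow_le_one_of_one_le_of_nonpos (by linarith) (by norm_num)))
  obtain ⟨θ, hθ0, hθ⟩ := prufer g hgc hg0 hg1 k θ₀ hk
  have hθc : Continuous θ := continuous_iff_continuousAt.2 fun x => (hθ x).continuousAt
  set V : ℝ → ℝ := fun x => -(g x) * sin (2 * θ x) with hVdef
  have hVc : Continuous V := by fun_prop
  have hVb : ∀ x, 0 ≤ x → |V x| ≤ h x / (1 + x) := fun x hx => by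
    refine le_trans ?_ (hhalf x hx)
    rw [← hge x hx]
    simp only [hVdef, abs_mul, abs_neg, abs_of_nonneg (hg0 x)]
    exact mul_le_of_le_one_right (hg0 x) (abs_sin_le_one _)
  refine ⟨θ, V, hVc.continuousOn, fun x hx => ?_, fun x hx => hVb x hx, hθ0,
    fun x _ => hθ x, fun u hu => ?_⟩
  · rw [← hge x hx]
  set J : ℝ → ℝ := fun x => ∫ y in (0:ℝ)..x, V y * sin (2 * θ y) with hJ
  have hJd : ∀ x, HasDerivAt J (V x * sin (2 * θ x)) x := fun x => by
    have hc : Continuous (fun y => V y * sin (2 * θ y)) := by fun_prop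
    exact hc.integral_hasStrictDerivAt 0 x |>.hasDerivAt
  set R : ℝ → ℝ := fun x => exp ((1 / (2 * k)) * J x) with hR
  have hRd : ∀ x, HasDerivAt R (R x * ((1 / (2 * k)) * (V x * sin (2 * θ x)))) x := fun x =>
    ((hJd x).const_mul (1 / (2 * k))).exp
  have hRc : Continuous R := continuous_iff_continuousAt.2 fun x => (hRd x).continuousAt
  have huR : u = fun x => R x * sin (θ x) := funext hu
  have huc : Continuous u := by rw [huR]; fun_prop
  constructor
  · refine ⟨fun x => k * (R x * cos (θ x)), fun x => V x * u x - k^2 * u x, ?_, ?_, ?_, ?_⟩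
    · intro x _
      rw [huR]
      refine ((hRd x).mul (hθ x).sin).congr_deriv ?_
      change _ * sin (θ x) + R x * (cos (θ x) * (k - (1/k) * V x * sin (θ x)^2)) = _
      rw [sin_two_mul]
      field_simp
      ring
    · intro x _
      rw [huR]
      refine (((hRd x).mul (hθ x).cos).const_mul k).congr_deriv ?_
      change k * (_ * cos (θ x) + R x * (- sin (θ x) * (k - (1/k) * V x * sin (θ x)^2))) = _
      rw [sin_two_mul]
      have := sin_sq_add_cos_sq (θ x)
      field_simp
      rw [cos_sq']
      ring
    · fun_prop
    · intro x _
      ring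
  · obtain ⟨x0, hx0, hx0'⟩ : ∃ x0 : ℝ, 0 ≤ x0 ∧ ∀ x, x0 ≤ x → 8 * k ≤ h x := by
      obtain ⟨a, ha⟩ := Filter.eventually_atTop.1 (hinf.eventually_ge_atTop (8*k))
      exact ⟨max a 0, le_max_right _ _, fun x hx => ha x ((le_max_left _ _).trans hx)⟩
    obtain ⟨C, hC⟩ := decay (fun x => - J x) θ V g k x0 hk hx0 hθ
      (fun x => by
        refine (hJd x).neg.congr_deriv ?_
        simp only [hVdef]; ring)
      (fun x hx => by
        have hxn : 0 ≤ x := hx0.trans hx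
        have := hx0' x hx
        rw [hge x hxn, div_le_div_iff₀ (by linarith) (by linarith)]
        nlinarith)
      (fun x hx => (hVb x hx).trans (hrp x hx))
    have hsplit : Ici (0:ℝ) = Icc 0 x0 ∪ Ici x0 := (Icc_union_Ici_eq_Ici hx0).symm
    rw [hsplit]
    refine IntegrableOn.union ((huc.pow 2).continuousOn.integrableOn_Icc) ?_
    refine Integrable.mono' ((integrable_inv_one_add_sq.const_mul (exp (C/k))).integrableOn)
      (huc.pow 2).aestronglyMeasurable ?_
    refine ae_restrict_of_forall_mem measurableSet_Ici fun x hx => ?_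
    have hxn : 0 ≤ x := hx0.trans hx
    have hp : 0 < 1 + x := by linarith
    have h1 := hC x hx
    have h2 : R x ^ 2 ≤ exp (C/k) * ((1+x)^2)⁻¹ := by
      have a1 : R x ^ 2 = exp (J x / k) := by
        simp only [hR]
        rw [← exp_nat_mul]
        congr 1
        push_cast
        field_simp
      have a2 : exp (C/k) * ((1+x)^2)⁻¹ = exp (C/k - 2 * log (1+x)) := by
        rw [exp_sub, two_mul, exp_add, exp_log hp, div_eq_mul_inv (exp _), sq]
      rw [a1, a2, exp_le_exp]
      have : C/k - 2 * log (1+x) = (C - 2 * k * log (1+x)) / k := by field_simp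
      rw [this]
      exact div_le_div_of_nonneg_right (by linarith) hk.le
    rw [norm_eq_abs, abs_of_nonneg (sq_nonneg _), huR]
    have h3 : ((1+x)^2)⁻¹ ≤ (1 + x^2)⁻¹ := inv_anti₀ (by positivity) (by nlinarith)
    calc (R x * sin (θ x))^2 = R x ^2 * sin (θ x)^2 := by ring
      _ ≤ R x ^ 2 * 1 := by gcongr; exact sin_sq_le_one _
      _ ≤ exp (C/k) * ((1+x)^2)⁻¹ := by linarith
      _ ≤ _ := by gcongr
end

section
/- For every continuous nondecreasing function h : [0,∞) → (0,∞) with h(x) → ∞ as x → ∞, there exists a continuous potential V : [0,∞) → ℝ with |V(x)| ≤ h(x)/(1+x) for all x ≥ 0 such that the set of energies E ∈ (0,∞) for which the eigenfunction equation −u'' + V u = E u admits a nonzero twice continuously differentiable solution u on [0,∞) with u(0) = 0 and ∫₀^∞ |u(x)|² dx < ∞ is dense in (0,∞). -/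
open Real Set MeasureTheory

/-- `E` is a Dirichlet eigenvalue of the half-line Schrödinger operator `-d²/dx² + V`:
the equation `-u'' + V u = E u` has a nonzero twice continuously differentiable
solution on `[0,∞)` with `u(0) = 0` which is square integrable. -/
def IsDirichletEigenvalue (V : ℝ → ℝ) (E : ℝ) : Prop :=
  ∃ u u' u'' : ℝ → ℝ,
    (∀ x ∈ Ici (0 : ℝ), HasDerivAt u (u' x) x) ∧
    (∀ x ∈ Ici (0 : ℝ), HasDerivAt u' (u'' x) x) ∧
    ContinuousOn u'' (Ici (0 : ℝ)) ∧
    (∀ x ∈ Ici (0 : ℝ), -u'' x + V x * u x = E * u x) ∧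
    u 0 = 0 ∧ (∃ x ∈ Ici (0 : ℝ), u x ≠ 0) ∧
    IntegrableOn (fun x => u x ^ 2) (Ici (0 : ℝ))


noncomputable def dsVF (k : ℕ → ℝ) (g : ℕ → ℝ → ℝ) (N : ℕ) (t : ℝ) (y : Fin N → ℝ) : Fin N → ℝ :=
  fun i => k i + (∑ l : Fin N, g l t * sin (2 * y l)) * sin (y i) ^ 2 / k i

lemma ds_abs_sin_sub (a b : ℝ) : |sin a - sin b| ≤ |a - b| := by
  have := Real.abs_sin_sub_sin_le a b
  exact this

lemma dsVF_bdd (k : ℕ → ℝ) (hk : ∀ j, 0 < k j) (g : ℕ → ℝ → ℝ) (c : ℕ → ℝ)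
    (hg : ∀ j x, |g j x| ≤ c j) (N : ℕ) : ∃ L : NNReal, ∀ t y, ‖dsVF k g N t y‖ ≤ L := by
  have hc : ∀ j, 0 ≤ c j := fun j => (abs_nonneg _).trans (hg j 0)
  set G := ∑ l : Fin N, c l with hG
  have hG0 : 0 ≤ G := Finset.sum_nonneg fun l _ => hc l
  have hL : 0 ≤ ∑ i : Fin N, (k i + G / k i) :=
    Finset.sum_nonneg fun i _ => add_nonneg (hk i).le (div_nonneg hG0 (hk i).le)
  refine ⟨⟨_, hL⟩, fun t y => ?_⟩
  change _ ≤ ∑ i : Fin N, (k i + G / k i)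
  rw [pi_norm_le_iff_of_nonneg hL]
  intro i
  have h1 : |∑ l : Fin N, g l t * sin (2 * y l)| ≤ G := by
    refine (Finset.abs_sum_le_sum_abs _ _).trans (Finset.sum_le_sum fun l _ => ?_)
    rw [abs_mul]
    exact (mul_le_of_le_one_right (abs_nonneg _) (abs_sin_le_one _)).trans (hg l t)
  have h2 : ‖dsVF k g N t y i‖ ≤ k i + G / k i := by
    simp only [dsVF, Real.norm_eq_abs]
    refine (abs_add_le _ _).trans ?_
    rw [abs_of_pos (hk i), abs_div, abs_of_pos (hk i), abs_mul,
      abs_of_nonneg (sq_nonneg (sin (y i)))]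
    have := hk i
    gcongr
    exact (mul_le_of_le_one_right (abs_nonneg _) (sin_sq_le_one _)).trans h1
  refine h2.trans ?_
  exact Finset.single_le_sum (f := fun i : Fin N => k i + G / k i)
    (fun i _ => add_nonneg (hk i).le (div_nonneg hG0 (hk i).le)) (Finset.mem_univ i)

lemma dsVF_lip (k : ℕ → ℝ) (hk : ∀ j, 0 < k j) (g : ℕ → ℝ → ℝ) (c : ℕ → ℝ)
    (hg : ∀ j x, |g j x| ≤ c j) (N : ℕ) : ∃ K : NNReal, ∀ t, LipschitzWith K (dsVF k g N t) := by
  have hc : ∀ j, 0 ≤ c j := fun j => (abs_nonneg _).trans (hg j 0)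
  set G := ∑ l : Fin N, c l with hG
  have hG0 : 0 ≤ G := Finset.sum_nonneg fun l _ => hc l
  have hn : ∀ i : Fin N, 0 ≤ 4 * G / k i := fun i => div_nonneg (by positivity) (hk i).le
  have hL : 0 ≤ ∑ i : Fin N, (4 * G / k i) := Finset.sum_nonneg fun i _ => hn i
  refine ⟨⟨_, hL⟩, fun t => LipschitzWith.of_dist_le_mul fun y z => ?_⟩
  rw [dist_pi_le_iff (by positivity)]
  intro i
  have h1 : ∀ y : Fin N → ℝ, |∑ l : Fin N, g l t * sin (2 * y l)| ≤ G := by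
    intro y
    refine (Finset.abs_sum_le_sum_abs _ _).trans (Finset.sum_le_sum fun l _ => ?_)
    rw [abs_mul]
    exact (mul_le_of_le_one_right (abs_nonneg _) (abs_sin_le_one _)).trans (hg l t)
  have hd : ∀ l, |y l - z l| ≤ dist y z := fun l => by
    have := dist_le_pi_dist y z l
    rwa [Real.dist_eq] at this
  have h2 : |∑ l : Fin N, g l t * sin (2 * y l) - ∑ l : Fin N, g l t * sin (2 * z l)|
      ≤ G * (2 * dist y z) := by
    rw [← Finset.sum_sub_distrib, hG, Finset.sum_mul]
    refine (Finset.abs_sum_le_sum_abs _ _).trans (Finset.sum_le_sum fun l _ => ?_)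
    rw [← mul_sub, abs_mul]
    refine mul_le_mul (hg l t) ?_ (abs_nonneg _) (hc l)
    refine (ds_abs_sin_sub _ _).trans ?_
    rw [← mul_sub, abs_mul, abs_two]
    linarith [hd l]
  have h3 : |sin (y i) ^ 2 - sin (z i) ^ 2| ≤ 2 * dist y z := by
    have : sin (y i) ^ 2 - sin (z i) ^ 2 = (sin (y i) + sin (z i)) * (sin (y i) - sin (z i)) := by
      ring
    rw [this, abs_mul]
    refine mul_le_mul ?_ ((ds_abs_sin_sub _ _).trans (hd i)) (abs_nonneg _) (by norm_num)
    refine (abs_add_le _ _).trans ?_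
    linarith [abs_sin_le_one (y i), abs_sin_le_one (z i)]
  have h4 : dist (dsVF k g N t y i) (dsVF k g N t z i) ≤ 4 * G / k i * dist y z := by
    rw [Real.dist_eq]
    simp only [dsVF]
    set A := ∑ l : Fin N, g l t * sin (2 * y l)
    set B := ∑ l : Fin N, g l t * sin (2 * z l)
    have : k i + A * sin (y i) ^ 2 / k i - (k i + B * sin (z i) ^ 2 / k i)
      = ((A - B) * sin (y i) ^ 2 + B * (sin (y i) ^ 2 - sin (z i) ^ 2)) / k i := by ring
    rw [this, abs_div, abs_of_pos (hk i), div_mul_eq_mul_div]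
    refine div_le_div_of_nonneg_right ?_ (hk i).le
    refine (abs_add_le _ _).trans ?_
    rw [abs_mul, abs_mul, abs_of_nonneg (sq_nonneg (sin (y i)))]
    have e1 : |A - B| * sin (y i) ^ 2 ≤ G * (2 * dist y z) :=
      (mul_le_of_le_one_right (abs_nonneg _) (sin_sq_le_one _)).trans h2
    have e2 : |B| * |sin (y i) ^ 2 - sin (z i) ^ 2| ≤ G * (2 * dist y z) :=
      mul_le_mul (h1 z) h3 (abs_nonneg _) hG0
    linarith
  refine h4.trans ?_
  refine mul_le_mul_of_nonneg_right ?_ dist_nonneg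
  exact Finset.single_le_sum (f := fun i : Fin N => 4 * G / k i)
    (fun i _ => hn i) (Finset.mem_univ i)

lemma ds_ode_N (k : ℕ → ℝ) (hk : ∀ j, 0 < k j) (g : ℕ → ℝ → ℝ) (c : ℕ → ℝ)
    (hg : ∀ j x, |g j x| ≤ c j) (hgc : ∀ j, Continuous (g j)) (N : ℕ) :
    ∃ α : ℝ → Fin N → ℝ, α 0 = 0 ∧ ∀ t ∈ Ioo (-(N:ℝ)) N, HasDerivAt α (dsVF k g N t (α t)) t := by
  obtain ⟨L, hL⟩ := dsVF_bdd k hk g c hg N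
  obtain ⟨K, hK⟩ := dsVF_lip k hk g c hg N
  have hN : (0:ℝ) ≤ N := Nat.cast_nonneg N
  have hpl : IsPicardLindelof (dsVF k g N) (tmin := -(N:ℝ)) (tmax := N) ⟨0, by simp⟩
      (0 : Fin N → ℝ) (L * N) 0 L K := by
    refine ⟨fun t _ => (hK t).lipschitzOnWith, fun y _ => ?_, fun t _ y _ => hL t y, ?_⟩
    · apply Continuous.continuousOn
      refine continuous_pi fun i => ?_
      simp only [dsVF]
      have := hgc
      fun_prop
    · simp
  obtain ⟨α, h0, hα⟩ := hpl.exists_eq_forall_mem_Icc_hasDerivWithinAt₀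
  refine ⟨α, h0, fun t ht => (hα t (Ioo_subset_Icc_self ht)).hasDerivAt (Icc_mem_nhds ht.1 ht.2)⟩

lemma ds_ode (k : ℕ → ℝ) (hk : ∀ j, 0 < k j) (g : ℕ → ℝ → ℝ) (c : ℕ → ℝ)
    (hg : ∀ j x, |g j x| ≤ c j) (hgc : ∀ j, Continuous (g j))
    (hg0 : ∀ (j : ℕ) (x : ℝ), x ≤ (j:ℝ) → g j x = 0) :
    ∃ θ : ℕ → ℝ → ℝ, (∀ j, θ j 0 = 0) ∧ ∀ j (N : ℕ) (x : ℝ), x < N →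
      HasDerivAt (θ j) (k j + (∑ l ∈ Finset.range N, g l x * sin (2 * θ l x))
        * sin (θ j x) ^ 2 / k j) x := by
  choose α h0 hα using ds_ode_N k hk g c hg hgc
  -- scalar version
  set β : ℕ → ℕ → ℝ → ℝ := fun N j x => if h : j < N then α N x ⟨j, h⟩ else 0 with hβ
  have hsum : ∀ N M : ℕ, N ≤ M → ∀ x : ℝ, x ≤ N → ∀ f : ℕ → ℝ,
      ∑ l ∈ Finset.range M, g l x * f l = ∑ l ∈ Finset.range N, g l x * f l := by
    intro N M hNM x hx f
    symm
    apply Finset.sum_subset (Finset.range_mono hNM)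
    intro l _ hl
    rw [hg0 l x, zero_mul]
    simp only [Finset.mem_range, not_lt] at hl
    exact hx.trans (by exact_mod_cast hl)
  have hβ' : ∀ N j : ℕ, j < N → ∀ x ∈ Ioo (-(N:ℝ)) N, HasDerivAt (β N j)
      (k j + (∑ l ∈ Finset.range N, g l x * sin (2 * β N l x)) * sin (β N j x) ^ 2 / k j) x := by
    intro N j hj x hx
    have h1 := (hasDerivAt_pi.1 (hα N x hx)) ⟨j, hj⟩
    have h2 : β N j = fun x => α N x ⟨j, hj⟩ := by
      funext y; simp [hβ, hj]
    rw [h2]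
    refine h1.congr_deriv ?_
    simp only [dsVF]
    rw [Finset.sum_range]
    simp [hβ]
  have hβ0 : ∀ N j, β N j 0 = 0 := by
    intro N j
    simp only [hβ]
    split_ifs with h
    · rw [h0]; rfl
    · rfl
  have huniq : ∀ N M j : ℕ, j < N → N ≤ M → ∀ x ∈ Ioo (-(N:ℝ)) N, β N j x = β M j x := by
    intro N M j hj hNM x hx
    obtain ⟨K, hK⟩ := dsVF_lip k hk g c hg N
    have hNM' : (N:ℝ) ≤ M := by exact_mod_cast hNM
    have hN0 : (0:ℝ) < N := by exact_mod_cast (Nat.zero_le j).trans_lt hj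
    have key := ODE_solution_unique_of_mem_Ioo (v := dsVF k g N) (K := K) (s := fun _ => univ)
      (a := -(N:ℝ)) (b := N) (t₀ := 0) (f := α N) (g := fun t i => β M i t)
      (fun t _ => (hK t).lipschitzOnWith) ⟨by linarith, hN0⟩
      (fun t ht => ⟨hα N t ht, mem_univ _⟩) (fun t ht => ⟨?_, mem_univ _⟩) ?_
    · have := congrFun (key hx) ⟨j, hj⟩
      simp only at this
      rw [← this]
      simp [hβ, hj]
    · rw [hasDerivAt_pi]
      intro i
      have := hβ' M i (i.2.trans_le hNM) t ⟨by linarith [ht.1], ht.2.trans_le hNM'⟩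
      refine this.congr_deriv ?_
      simp only [dsVF]
      rw [hsum N M hNM t ht.2.le (fun l => sin (2 * β M l t)), Finset.sum_range]
    · rw [h0]; funext i; simp [hβ0]
  -- glue
  set n : ℕ → ℝ → ℕ := fun j x => max (j+1) (⌈|x|⌉₊ + 1) with hn
  have hnx : ∀ j x, |x| < n j x := by
    intro j x
    have h1 := Nat.le_ceil |x|
    have h2 : ((⌈|x|⌉₊ + 1 : ℕ):ℝ) ≤ n j x := by exact_mod_cast le_max_right _ _
    push_cast at h2
    linarith
  have hnj : ∀ j x, j < n j x := fun j x => lt_of_lt_of_le (Nat.lt_succ_self j) (le_max_left _ _)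
  have hglue : ∀ (j M : ℕ) (x : ℝ), j < M → |x| < (M:ℝ) → β (n j x) j x = β M j x := by
    intro j M x hj hx
    rcases le_total (n j x) M with h | h
    · exact huniq _ _ j (hnj j x) h x (abs_lt.1 (hnx j x))
    · exact (huniq _ _ j hj h x (abs_lt.1 hx)).symm
  refine ⟨fun j x => β (n j x) j x, fun j => hβ0 _ _, fun j N x hxN => ?_⟩
  set M := max (n j x) N with hM
  have hjM : j < M := (hnj j x).trans_le (le_max_left _ _)
  have hxM : |x| < M := (hnx j x).trans_le (by exact_mod_cast le_max_left _ _)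
  have hd := hβ' M j hjM x (abs_lt.1 hxM)
  have hev : (fun y => β (n j y) j y) =ᶠ[nhds x] β M j := by
    have : ∀ᶠ y in nhds x, |y| < (M:ℝ) := continuous_abs.continuousAt.eventually_lt
      continuousAt_const hxM
    filter_upwards [this] with y hy
    exact hglue j M y hjM hy
  have h3 := hd.congr_of_eventuallyEq hev
  refine h3.congr_deriv ?_
  beta_reduce
  rw [hsum N M (le_max_right _ _) x hxN.le (fun l => sin (2 * β M l x)), hglue j M x hjM hxM]
  congr 3
  apply Finset.sum_congr rfl
  intro l hl
  rw [hglue l M x ((Finset.mem_range.1 hl).trans_le (le_max_right _ _)) hxM]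

noncomputable def dsB (R x : ℝ) : ℝ := (max (x - R) 0) ^ 2 / (1 + |x|) ^ 3

lemma dsB_cont (R : ℝ) : Continuous (dsB R) := by
  unfold dsB
  refine Continuous.div (by fun_prop) (by fun_prop) fun x => ?_
  positivity

lemma dsB_nonneg (R x : ℝ) : 0 ≤ dsB R x := by
  unfold dsB; positivity

lemma dsB_zero {R x : ℝ} (h : x ≤ R) : dsB R x = 0 := by
  unfold dsB
  rw [max_eq_right (by linarith)]; simp

lemma dsB_le {R : ℝ} (hR : 0 ≤ R) (x : ℝ) : dsB R x ≤ 1 / (1 + |x|) := by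
  unfold dsB
  have h0 : 0 < 1 + |x| := by positivity
  have h1 : max (x - R) 0 ≤ 1 + |x| := max_le (by linarith [le_abs_self x]) h0.le
  have h2 : (max (x - R) 0) ^ 2 ≤ (1 + |x|) ^ 2 := by gcongr
  rw [div_le_div_iff₀ (by positivity) h0]
  nlinarith

lemma dsB_lower {R x : ℝ} (hR : 0 ≤ R) (hx : 0 ≤ x) :
    1 / (1 + x) - 2 * (1 + R) / (1 + x) ^ 2 ≤ dsB R x := by
  unfold dsB
  rw [abs_of_nonneg hx]
  have h0 : 0 < 1 + x := by positivity
  have : 1 / (1 + x) - 2 * (1 + R) / (1 + x) ^ 2 =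
      ((1 + x) ^ 2 - 2 * (1 + R) * (1 + x)) / (1 + x) ^ 3 := by
    field_simp
  rw [this]
  gcongr
  rcases le_total x R with h | h
  · rw [max_eq_right (by linarith)]
    nlinarith
  · rw [max_eq_left (by linarith)]
    nlinarith [sq_nonneg (1 + R)]

lemma ds_max_sq (R x : ℝ) : HasDerivAt (fun y => (max (y - R) 0) ^ 2) (2 * max (x - R) 0) x := by
  rcases lt_trichotomy x R with h | h | h
  · rw [max_eq_right (by linarith)]
    have : (fun y => (max (y - R) 0) ^ 2) =ᶠ[nhds x] fun _ => (0:ℝ) := by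
      filter_upwards [eventually_lt_nhds h] with y hy
      rw [max_eq_right (by linarith)]; simp
    simpa using (hasDerivAt_const x (0:ℝ)).congr_of_eventuallyEq this
  · subst h
    rw [hasDerivAt_iff_isLittleO]
    simp only [sub_self, max_self, mul_zero, smul_zero, sub_zero, ne_eq, OfNat.ofNat_ne_zero,
      not_false_eq_true, zero_pow]
    have h1 : (fun y : ℝ => (max (y - x) 0) ^ 2) =O[nhds x] fun y => (y - x) ^ 2 := by
      refine Asymptotics.IsBigO.of_bound 1 (Filter.Eventually.of_forall fun y => ?_)
      rw [one_mul, Real.norm_eq_abs, Real.norm_eq_abs, abs_of_nonneg (sq_nonneg _),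
        abs_of_nonneg (sq_nonneg _)]
      rcases le_total y x with h | h
      · rw [max_eq_right (by linarith)]; nlinarith
      · rw [max_eq_left (by linarith)]
    refine h1.trans_isLittleO ?_
    have h5 := Asymptotics.isLittleO_pow_sub_sub x (m := 2) (by norm_num)
    simpa [Real.norm_eq_abs, sq_abs] using h5
  · rw [max_eq_left (by linarith)]
    have : (fun y => (max (y - R) 0) ^ 2) =ᶠ[nhds x] fun y => (y - R) ^ 2 := by
      filter_upwards [eventually_gt_nhds h] with y hy
      rw [max_eq_left (by linarith)]
    have h2 := (((hasDerivAt_id x).sub_const R).pow 2).congr_of_eventuallyEq this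
    simpa using h2

lemma dsB_deriv {R x : ℝ} (hR : 0 ≤ R) (hx : 0 < x) :
    ∃ d, HasDerivAt (dsB R) d x ∧ |d| ≤ 5 / (1 + x) ^ 2 ∧ (x ≤ R → d = 0) := by
  have h0 : 0 < 1 + x := by positivity
  have hev : dsB R =ᶠ[nhds x] fun y => (max (y - R) 0) ^ 2 / (1 + y) ^ 3 := by
    filter_upwards [eventually_gt_nhds hx] with y hy
    simp [dsB, abs_of_pos hy]
  have hq : HasDerivAt (fun y : ℝ => (1 + y) ^ 3) (3 * (1 + x) ^ 2) x := by
    simpa using ((hasDerivAt_id x).const_add 1).fun_pow 3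
  have h1 := ((ds_max_sq R x).fun_div hq (by positivity)).congr_of_eventuallyEq hev
  refine ⟨_, h1, ?_, ?_⟩
  · set m := max (x - R) 0 with hm
    have hm0 : 0 ≤ m := le_max_right _ _
    have hm1 : m ≤ 1 + x := max_le (by linarith) h0.le
    generalize 1 + x = z at *
    have : (2 * m * z ^ 3 - m ^ 2 * (3 * z ^ 2)) / (z ^ 3) ^ 2
      = (2 * m * z - 3 * m ^ 2) / z ^ 4 := by
      field_simp
    rw [this, abs_div, abs_of_pos (by positivity : 0 < z ^ 4),
      div_le_div_iff₀ (by positivity) (by positivity)]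
    have h3 : |2 * m * z - 3 * m ^ 2| ≤ 5 * z ^ 2 := by
      rw [abs_le]; constructor <;> nlinarith
    calc _ ≤ 5 * z ^ 2 * z ^ 2 := by gcongr
      _ = _ := by ring
  · intro h
    rw [max_eq_right (by linarith)]; simp

lemma ds_osc {g φ : ℝ → ℝ} {g' ω e x : ℝ} (hg : HasDerivAt g g' x) (hφ : HasDerivAt φ (ω + e) x) :
    ∃ d, HasDerivAt (fun y => g y * sin (2 * φ y) / (2 * ω)) d x ∧
      |d - (if ω = 0 then 0 else g x * cos (2 * φ x))| ≤ (|g x| * |e| + |g'|) * (1 / |ω|) := by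
  have h1 := (hg.mul (hφ.const_mul 2).sin).div_const (2 * ω)
  refine ⟨_, h1, ?_⟩
  by_cases hω : ω = 0
  · simp [hω]
  · rw [if_neg hω]
    have : (g' * sin (2 * φ x) + g x * (cos (2 * φ x) * (2 * (ω + e)))) / (2 * ω)
        - g x * cos (2 * φ x) = (g x * e * cos (2 * φ x) + g' * (sin (2 * φ x) / 2)) * (1 / ω) := by
      field_simp; ring
    rw [this, abs_mul, abs_div, abs_one]
    refine mul_le_mul_of_nonneg_right ?_ (by positivity)
    refine (abs_add_le _ _).trans ?_
    rw [abs_mul, abs_mul, abs_mul]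
    refine add_le_add (mul_le_of_le_one_right (by positivity) (abs_cos_le_one _))
      (mul_le_of_le_one_right (by positivity) ?_)
    rw [abs_div, abs_two]
    linarith [abs_sin_le_one (2 * φ x)]

noncomputable def dsA (k : ℕ → ℝ) (i j : ℕ) : ℝ :=
  k j / k i * (1 / k i + 1 / k j + 5) * (1 / |k i - k j| + 1 / (k i + k j))

noncomputable def dsPhi (k R : ℕ → ℝ) (θ : ℕ → ℝ → ℝ) (i j : ℕ) (y : ℝ) : ℝ :=
  1 / (4 * k i) * (4 * k j * dsB (R j) y * sin (2 * (θ i y - θ j y)) / (2 * (k i - k j))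
    - 4 * k j * dsB (R j) y * sin (2 * (θ i y + θ j y)) / (2 * (k i + k j)))

noncomputable def dsS (x : ℝ) : ℝ := √√(1 + x)

lemma dsS_pow {x : ℝ} (hx : 0 ≤ x) : dsS x ^ 4 = 1 + x := by
  unfold dsS
  have : √√(1 + x) ^ 4 = (√√(1 + x) ^ 2) ^ 2 := by ring
  rw [this, sq_sqrt (by positivity), sq_sqrt (by positivity)]

lemma dsS_one {x : ℝ} (hx : 0 ≤ x) : 1 ≤ dsS x := by
  unfold dsS
  rw [one_le_sqrt, one_le_sqrt]; linarith

lemma ds_err (g e g' kj ki s : ℝ) (hi : 0 < ki) (hj : 0 < kj) (hs : 1 ≤ s)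
    (hg : |g| ≤ 4 * kj / s ^ 4) (he : |e| ≤ (1 / ki + 1 / kj) * (1 / s ^ 3))
    (hg' : |g'| ≤ 4 * kj * 5 / s ^ 8) :
    |g| * |e| + |g'| ≤ 4 * kj * (1 / ki + 1 / kj + 5) / s ^ 7 := by
  have hs0 : 0 < s := by linarith
  have h1 : |g| * |e| ≤ 4 * kj / s ^ 4 * ((1 / ki + 1 / kj) * (1 / s ^ 3)) :=
    mul_le_mul hg he (abs_nonneg _) (by positivity)
  have h2 : 4 * kj * 5 / s ^ 8 ≤ 4 * kj * 5 / s ^ 7 := by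
    gcongr
    norm_num
  have h3 : 4 * kj / s ^ 4 * ((1 / ki + 1 / kj) * (1 / s ^ 3)) + 4 * kj * 5 / s ^ 7
    = 4 * kj * (1 / ki + 1 / kj + 5) / s ^ 7 := by
    field_simp
  linarith

lemma ds_term (k R : ℕ → ℝ) (θ : ℕ → ℝ → ℝ) (V : ℝ → ℝ) (hk : ∀ j, 0 < k j)
    (hinj : Function.Injective k) (hR : ∀ j, 0 ≤ R j)
    (hθ : ∀ j x, HasDerivAt (θ j) (k j - V x * sin (θ j x) ^ 2 / k j) x)
    (hV : ∀ x, 0 < x → |V x| ≤ dsS x / (1 + x)) (i j : ℕ) (x : ℝ) (hx : 0 < x) :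
    ∃ d, HasDerivAt (dsPhi k R θ i j) d x ∧
      d - 1 / (2 * k i) * (4 * k j * dsB (R j) x * sin (2 * θ j x) * sin (2 * θ i x)) ≤
        -(if i = j then dsB (R j) x else 0) + (if R j < x then dsA k i j else 0) / dsS x ^ 7 := by
  have hi := hk i
  have hj := hk j
  have hs := dsS_one hx.le
  have hs4 := dsS_pow hx.le
  obtain ⟨b, hb, hb1, hb2⟩ := dsB_deriv (hR j) hx
  have hBle := dsB_le (hR j) x
  have hB0 := dsB_nonneg (R j) x
  rw [abs_of_pos hx, ← hs4] at hBle
  rw [← hs4] at hb1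
  have hg : HasDerivAt (fun y => 4 * k j * dsB (R j) y) (4 * k j * b) x := hb.const_mul _
  set s := dsS x with hsdef
  have hs0 : 0 < s := by linarith
  have hVx : |V x| ≤ 1 / s ^ 3 := by
    refine (hV x hx).trans (le_of_eq ?_)
    rw [← hs4, ← hsdef]; field_simp
  set Si := sin (θ i x) ^ 2 with hSi
  set Sj := sin (θ j x) ^ 2 with hSj
  have hte : ∀ l, |V x * sin (θ l x) ^ 2 / k l| ≤ 1 / k l * (1 / s ^ 3) := by
    intro l
    rw [abs_div, abs_mul, abs_of_pos (hk l), abs_of_nonneg (sq_nonneg (sin (θ l x))), div_eq_mul_one_div, mul_comm]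
    have := hk l
    refine mul_le_mul_of_nonneg_left ?_ (by positivity)
    exact (mul_le_of_le_one_right (abs_nonneg _) (sin_sq_le_one _)).trans hVx
  have hm : HasDerivAt (fun y => θ i y - θ j y)
      ((k i - k j) + (- (V x * Si / k i) + V x * Sj / k j)) x :=
    ((hθ i x).sub (hθ j x)).congr_deriv (by ring)
  have hp : HasDerivAt (fun y => θ i y + θ j y)
      ((k i + k j) + (- (V x * Si / k i) - V x * Sj / k j)) x :=
    ((hθ i x).add (hθ j x)).congr_deriv (by ring)
  have hem : |- (V x * Si / k i) + V x * Sj / k j| ≤ (1 / k i + 1 / k j) * (1 / s ^ 3) := by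
    refine (abs_add_le _ _).trans ?_
    rw [abs_neg]; linarith [hte i, hte j]
  have hep : |- (V x * Si / k i) - V x * Sj / k j| ≤ (1 / k i + 1 / k j) * (1 / s ^ 3) := by
    refine (abs_sub _ _).trans ?_
    rw [abs_neg]; linarith [hte i, hte j]
  obtain ⟨d1, hd1, hd1'⟩ := ds_osc hg hm
  obtain ⟨d2, hd2, hd2'⟩ := ds_osc hg hp
  refine ⟨_, (hd1.sub hd2).const_mul (1 / (4 * k i)), ?_⟩
  rw [if_neg (by positivity)] at hd2'
  set G := 4 * k j * dsB (R j) x with hG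
  -- error bound
  set T := if R j < x then 4 * k j * (1 / k i + 1 / k j + 5) / s ^ 7 else 0 with hT
  have hGabs : |G| ≤ 4 * k j / s ^ 4 := by
    rw [abs_of_nonneg (by positivity), hG, div_eq_mul_one_div]
    gcongr
  have hG'abs : |4 * k j * b| ≤ 4 * k j * 5 / s ^ 8 := by
    rw [abs_mul, abs_of_pos (by positivity : 0 < 4 * k j), mul_div_assoc]
    have : s ^ 8 = (s ^ 4) ^ 2 := by ring
    rw [this]
    gcongr
  have hE : ∀ e, |e| ≤ (1 / k i + 1 / k j) * (1 / s ^ 3) → |G| * |e| + |4 * k j * b| ≤ T := by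
    intro e he
    rw [hT]
    split_ifs with hRx
    · exact ds_err _ _ _ _ _ _ hi hj hs hGabs he hG'abs
    · push Not at hRx
      rw [hb2 hRx, hG, dsB_zero hRx]; simp
  have f1 := (abs_le.1 (hd1'.trans (mul_le_mul_of_nonneg_right (hE _ hem) (by positivity)))).2
  have f2 := (abs_le.1 (hd2'.trans (mul_le_mul_of_nonneg_right (hE _ hep) (by positivity)))).1
  rw [abs_of_pos (by positivity : 0 < k i + k j)] at f2
  have hTA : 1 / (4 * k i) * (T * (1 / |k i - k j|) + T * (1 / (k i + k j))) =
      (if R j < x then dsA k i j else 0) / s ^ 7 := by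
    rw [hT]
    split_ifs
    · unfold dsA; field_simp
    · simp
  rw [← hTA]
  have htrig : G * sin (2 * θ j x) * sin (2 * θ i x) =
      1 / 2 * (G * cos (2 * (θ i x - θ j x)) - G * cos (2 * (θ i x + θ j x))) := by
    rw [mul_sub 2, mul_add 2, cos_sub, cos_add]; ring
  rw [htrig]
  have hpos : 0 < 1 / (4 * k i) := by positivity
  have hlin : d1 - d2 - (G * cos (2 * (θ i x - θ j x)) - G * cos (2 * (θ i x + θ j x))) ≤
      -(if i = j then G else 0) + (T * (1 / |k i - k j|) + T * (1 / (k i + k j))) := by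
    by_cases hij : i = j
    · subst hij
      simp only [sub_self, if_true, mul_zero, cos_zero, mul_one] at f1 ⊢
      linarith
    · have : k i - k j ≠ 0 := fun h => hij (hinj (by linarith))
      rw [if_neg this] at f1
      rw [if_neg hij]
      linarith
  have := mul_le_mul_of_nonneg_left hlin hpos.le
  have hGi : 1 / (4 * k i) * (if i = j then G else 0) = if i = j then dsB (R j) x else 0 := by
    by_cases hij : i = j
    · subst hij
      simp only [if_true, hG]; field_simp
    · simp [hij]
  rw [← hGi]
  have e3 : 1 / (2 * k i) = 1 / (4 * k i) * 2 := by field_simp; norm_num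
  rw [e3]
  linarith

lemma dsPhi_abs (k R : ℕ → ℝ) (θ : ℕ → ℝ → ℝ) (hk : ∀ j, 0 < k j) (hR : ∀ j, 0 ≤ R j)
    (i j : ℕ) (x : ℝ) (hx : 0 ≤ x) :
    |dsPhi k R θ i j x| ≤ (if R j < x then dsA k i j else 0) / dsS x := by
  have hi := hk i
  have hj := hk j
  have hs := dsS_one hx
  have hs0 : 0 < dsS x := by linarith
  split_ifs with h
  · have hB : dsB (R j) x ≤ 1 / dsS x := by
      refine (dsB_le (hR j) x).trans ?_
      rw [abs_of_nonneg hx, ← dsS_pow hx]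
      gcongr
      exact le_self_pow₀ hs (by norm_num)
    have hB0 := dsB_nonneg (R j) x
    set B := dsB (R j) x with hBd
    have key : ∀ ω t : ℝ, |4 * k j * B * sin t / (2 * ω)| ≤ 4 * k j / dsS x * (1 / |ω|) := by
      intro ω t
      rw [abs_div, abs_mul, abs_mul 2 ω, abs_two, abs_of_nonneg (by positivity : 0 ≤ 4 * k j * B)]
      have h1 : 4 * k j * B * |sin t| ≤ 4 * k j / dsS x := by
        refine (mul_le_of_le_one_right (by positivity) (abs_sin_le_one _)).trans ?_
        rw [div_eq_mul_one_div]; gcongr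
      have h2 : 4 * k j * B * |sin t| / (2 * |ω|) = (4 * k j * B * |sin t|) * (1 / |ω|) / 2 := by
        rw [div_eq_mul_inv, mul_inv, one_div]; ring
      rw [h2]
      have h3 := mul_le_mul_of_nonneg_right h1 (by positivity : 0 ≤ 1 / |ω|)
      have h4 : 0 ≤ (4 * k j * B * |sin t|) * (1 / |ω|) := by positivity
      linarith
    unfold dsPhi
    rw [abs_mul, abs_of_pos (by positivity : 0 < 1 / (4 * k i))]
    have e1 := key (k i - k j) (2 * (θ i x - θ j x))
    have e2 := key (k i + k j) (2 * (θ i x + θ j x))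
    rw [abs_of_pos (by positivity : 0 < k i + k j)] at e2
    calc _ ≤ 1 / (4 * k i) * (4 * k j / dsS x * (1 / |k i - k j|) + 4 * k j / dsS x * (1 / (k i + k j))) := by
          refine mul_le_mul_of_nonneg_left ((abs_sub _ _).trans (add_le_add e1 e2)) (by positivity)
      _ = (k j / k i * 1 * (1 / |k i - k j| + 1 / (k i + k j))) / dsS x := by field_simp
      _ ≤ _ := by
          unfold dsA
          gcongr
          have : 0 < 1 / k i := by positivity
          have : 0 < 1 / k j := by positivity
          linarith
  · push Not at h
    simp [dsPhi, dsB_zero h]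

lemma ds_decay (k R D : ℕ → ℝ) (θ : ℕ → ℝ → ℝ) (V P : ℝ → ℝ) (hk : ∀ j, 0 < k j)
    (hinj : Function.Injective k) (hR : ∀ j, 0 ≤ R j)
    (hθ : ∀ j x, HasDerivAt (θ j) (k j - V x * sin (θ j x) ^ 2 / k j) x)
    (hVs : ∀ (N : ℕ) (x : ℝ), x < N →
      V x = -∑ l ∈ Finset.range N, 4 * k l * dsB (R l) x * sin (2 * θ l x))
    (hV : ∀ x, 0 < x → |V x| ≤ dsS x / (1 + x))
    (hD : ∀ (i N : ℕ) (x : ℝ), 0 ≤ x →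
      ∑ j ∈ Finset.range N, (if R j < x then dsA k i j else 0) ≤ D i * dsS x)
    (i : ℕ) (hP0 : P 0 = 0) (hP : ∀ x, HasDerivAt P (V x * sin (2 * θ i x) / (2 * k i)) x) :
    ∃ C, ∀ x, 0 ≤ x → P x ≤ C - log (1 + x) := by
  have hDi : 0 ≤ D i := by
    have h1 := hD i 0 0 le_rfl
    simp only [Finset.range_zero, Finset.sum_empty] at h1
    have h2 := dsS_one (le_refl (0:ℝ))
    by_contra h
    push Not at h
    nlinarith
  refine ⟨2 * (1 + R i) + 2 * D i + D i, fun X hX => ?_⟩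
  obtain ⟨N, hN⟩ := exists_nat_gt (max X i)
  have hXN : X < N := (le_max_left _ _).trans_lt hN
  have hiN : i < N := by exact_mod_cast (le_max_right _ _).trans_lt hN
  set M : ℝ → ℝ := fun x => P x + ∑ j ∈ Finset.range N, dsPhi k R θ i j x + log (1 + x)
    + 2 * (1 + R i) / (1 + x) + 2 * D i / √(1 + x) with hM
  have hPhic : ∀ j, Continuous (dsPhi k R θ i j) := by
    intro j
    have h1 : ∀ j, Continuous (θ j) := fun j =>
      continuous_iff_continuousAt.2 fun x => (hθ j x).continuousAt
    have := h1 i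
    have := h1 j
    have := dsB_cont (R j)
    unfold dsPhi
    fun_prop
  have hPc : Continuous P := continuous_iff_continuousAt.2 fun x => (hP x).continuousAt
  have hMc : ContinuousOn M (Icc 0 X) := by
    have h1 : ∀ x ∈ Icc 0 X, (1 + x) ≠ 0 := fun x hx => by linarith [hx.1]
    have h2 : ∀ x ∈ Icc 0 X, √(1 + x) ≠ 0 := fun x hx =>
      (Real.sqrt_pos.2 (by linarith [hx.1])).ne'
    have h3 : Continuous (fun x => ∑ j ∈ Finset.range N, dsPhi k R θ i j x) :=
      continuous_finsetSum _ fun j _ => hPhic j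
    have h4 : ContinuousOn (fun x : ℝ => 1 + x) (Icc 0 X) := by fun_prop
    exact ((((hPc.add h3).continuousOn.add (h4.log h1)).add (continuousOn_const.div h4 h1)).add
      (continuousOn_const.div h4.sqrt h2))
  have hMd : ∀ x ∈ Ioo 0 X, ∃ d, HasDerivAt M d x ∧ d ≤ 0 := by
    intro x hx
    have hx0 := hx.1
    have h1x : 0 < 1 + x := by linarith
    choose d hd hd' using fun j => ds_term k R θ V hk hinj hR hθ hV i j x hx0
    have hl : HasDerivAt (fun x : ℝ => 1 + x) 1 x := (hasDerivAt_id x).const_add 1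
    have hq := hl.sqrt h1x.ne'
    have hsq : 0 < √(1 + x) := Real.sqrt_pos.2 h1x
    have hall := ((((hP x).fun_add (HasDerivAt.fun_sum fun j (_ : j ∈ Finset.range N) => hd j)).fun_add
      (hl.log h1x.ne')).fun_add ((hasDerivAt_const x (2 * (1 + R i))).fun_div hl h1x.ne')).fun_add
      ((hasDerivAt_const x (2 * D i)).fun_div hq hsq.ne')
    refine ⟨_, hall, ?_⟩
    have hs := dsS_one hx0.le
    have hs4 := dsS_pow hx0.le
    have hs2 : √(1 + x) = dsS x ^ 2 := by
      unfold dsS; rw [sq_sqrt (Real.sqrt_nonneg _)]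
    have hs0 : 0 < dsS x := by linarith
    have hsum := Finset.sum_le_sum fun j (_ : j ∈ Finset.range N) => hd' j
    rw [Finset.sum_sub_distrib, Finset.sum_add_distrib, Finset.sum_neg_distrib, ← Finset.mul_sum,
      Finset.sum_ite_eq, if_pos (Finset.mem_range.2 hiN), ← Finset.sum_div] at hsum
    have hPd : V x * sin (2 * θ i x) / (2 * k i) = - (1 / (2 * k i) *
        ∑ l ∈ Finset.range N, 4 * k l * dsB (R l) x * sin (2 * θ l x) * sin (2 * θ i x)) := by
      rw [hVs N x (hx.2.trans hXN), ← Finset.sum_mul]; ring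
    rw [hPd]
    have hDx : (∑ j ∈ Finset.range N, (if R j < x then dsA k i j else 0)) / dsS x ^ 7
        ≤ D i / dsS x ^ 6 := by
      rw [div_le_div_iff₀ (by positivity) (by positivity)]
      calc _ ≤ D i * dsS x * dsS x ^ 6 := by
            gcongr
            exact hD i N x hx0.le
        _ = _ := by ring
    have hlow := dsB_lower (hR i) hx0.le
    have e1 : (0 * √(1 + x) - 2 * D i * (1 / (2 * √(1 + x)))) / √(1 + x) ^ 2 = - (D i / dsS x ^ 6) := by
      rw [hs2]; field_simp; ring
    have e2 : (0 * (1 + x) - 2 * (1 + R i) * 1) / (1 + x) ^ 2 = - (2 * (1 + R i) / (1 + x) ^ 2) := by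
      ring
    rw [e1, e2]
    linarith
  have hanti : AntitoneOn M (Icc 0 X) := by
    refine antitoneOn_of_deriv_nonpos (convex_Icc 0 X) hMc ?_ ?_
    · rw [interior_Icc]
      intro x hx
      obtain ⟨d, hd, _⟩ := hMd x hx
      exact hd.differentiableAt.differentiableWithinAt
    · rw [interior_Icc]
      intro x hx
      obtain ⟨d, hd, h⟩ := hMd x hx
      rw [hd.deriv]; exact h
  have hfin := hanti (left_mem_Icc.2 hX) (right_mem_Icc.2 hX) hX
  have hPhi0 : ∀ j, dsPhi k R θ i j 0 = 0 := fun j => by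
    simp [dsPhi, dsB_zero (hR j)]
  have hM0 : M 0 = 2 * (1 + R i) + 2 * D i := by
    simp [hM, hP0, hPhi0]
  have hPhiX : |∑ j ∈ Finset.range N, dsPhi k R θ i j X| ≤ D i := by
    have hs0 : 0 < dsS X := by linarith [dsS_one hX]
    refine (Finset.abs_sum_le_sum_abs _ _).trans ?_
    refine (Finset.sum_le_sum fun j _ => dsPhi_abs k R θ hk hR i j X hX).trans ?_
    rw [← Finset.sum_div, div_le_iff₀ hs0]
    exact hD i N X hX
  rw [hM0] at hfin
  simp only [hM] at hfin
  have p1 : 0 ≤ 2 * (1 + R i) / (1 + X) := by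
    have := hR i
    positivity
  have p2 : 0 ≤ 2 * D i / √(1 + X) := by positivity
  linarith [(abs_le.1 hPhiX).1]

lemma ds_active (a R : ℕ → ℝ) (x b : ℝ) (ha : ∀ j, 0 ≤ a j) (hb : 0 ≤ b)
    (h : ∀ J, R J < x → ∑ l ∈ Finset.range (J + 1), a l ≤ b) (N : ℕ) :
    ∑ j ∈ Finset.range N, (if R j < x then a j else 0) ≤ b := by
  induction N with
  | zero => simpa using hb
  | succ n ih =>
    by_cases hn : R n < x
    · refine le_trans (Finset.sum_le_sum fun j _ => ?_) (h n hn)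
      split_ifs
      · exact le_rfl
      · exact ha j
    · rw [Finset.sum_range_succ, if_neg hn, add_zero]; exact ih

lemma dsA_nonneg (k : ℕ → ℝ) (hk : ∀ j, 0 < k j) (i j : ℕ) : 0 ≤ dsA k i j := by
  have := hk i
  have := hk j
  unfold dsA; positivity

lemma dsS_tendsto : Filter.Tendsto dsS Filter.atTop Filter.atTop := by
  unfold dsS
  exact Real.tendsto_sqrt_atTop.comp (Real.tendsto_sqrt_atTop.comp
    (Filter.tendsto_atTop_add_const_left _ 1 Filter.tendsto_id))

lemma ds_freq : ∃ k : ℕ → ℝ, (∀ j, 0 < k j) ∧ Function.Injective k ∧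
    Ioi (0:ℝ) ⊆ closure (range fun j => k j ^ 2) := by
  have hinf : Infinite {q : ℚ // 0 < q} := by
    refine Infinite.of_injective (fun n : ℕ => (⟨(n:ℚ) + 1, by positivity⟩ : {q : ℚ // 0 < q})) ?_
    intro a b h
    simpa using h
  obtain ⟨e⟩ := nonempty_denumerable {q : ℚ // 0 < q}
  let f := (Denumerable.eqv {q : ℚ // 0 < q}).symm
  refine ⟨fun j => ((f j : ℚ) : ℝ), fun j => by
    have := (f j).2
    show (0:ℝ) < ((f j : ℚ) : ℝ)
    exact_mod_cast this, ?_, ?_⟩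
  · intro a b h
    have h' : ((f a : ℚ) : ℝ) = ((f b : ℚ) : ℝ) := h
    have : ((f a : ℚ)) = f b := by exact_mod_cast h'
    exact f.injective (Subtype.ext this)
  · intro E hE
    have hE' : 0 < E := hE
    rw [Metric.mem_closure_iff]
    intro ε hε
    obtain ⟨q, h1, h2⟩ := exists_rat_btwn (Real.sqrt_lt_sqrt hE'.le (by linarith : E < E + ε))
    have hq : (0:ℝ) < q := (Real.sqrt_nonneg _).trans_lt h1
    have hq' : 0 < q := by exact_mod_cast hq
    refine ⟨_, ⟨f.symm ⟨q, hq'⟩, rfl⟩, ?_⟩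
    simp only [Equiv.apply_symm_apply]
    have h3 := (Real.sqrt_lt' hq).1 h1
    have h4 := (Real.lt_sqrt hq.le).1 h2
    rw [Real.dist_eq, abs_lt]
    constructor <;> linarith

theorem dense_imbedded_point_spectrum
    (h : ℝ → ℝ) (hcont : ContinuousOn h (Ici (0 : ℝ)))
    (hpos : ∀ x ∈ Ici (0 : ℝ), 0 < h x)
    (hmono : MonotoneOn h (Ici (0 : ℝ)))
    (hinf : Filter.Tendsto h Filter.atTop Filter.atTop) :
    ∃ V : ℝ → ℝ, ContinuousOn V (Ici (0 : ℝ)) ∧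
      (∀ x ∈ Ici (0 : ℝ), |V x| ≤ h x / (1 + x)) ∧
      Ioi (0 : ℝ) ⊆ closure {E : ℝ | 0 < E ∧ IsDirichletEigenvalue V E} := by
  obtain ⟨k, hk, hinj, hdense⟩ := ds_freq
  have hRex : ∀ j : ℕ, ∃ r : ℝ, (j:ℝ) ≤ r ∧ ∀ x, r ≤ x →
      (∑ l ∈ Finset.range (j + 1), 4 * k l ≤ h x) ∧
      (∑ l ∈ Finset.range (j + 1), 4 * k l ≤ dsS x) ∧
      (∑ i ∈ Finset.range (j + 1), ∑ l ∈ Finset.range (j + 1), dsA k i l ≤ dsS x) := by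
    intro j
    have h1 := (hinf.eventually_ge_atTop (∑ l ∈ Finset.range (j + 1), 4 * k l)).and
      ((dsS_tendsto.eventually_ge_atTop (∑ l ∈ Finset.range (j + 1), 4 * k l)).and
      (dsS_tendsto.eventually_ge_atTop
        (∑ i ∈ Finset.range (j + 1), ∑ l ∈ Finset.range (j + 1), dsA k i l)))
    obtain ⟨r, hr⟩ := Filter.eventually_atTop.1 h1
    exact ⟨max j r, le_max_left _ _, fun x hx => hr x ((le_max_right _ _).trans hx)⟩
  choose R hRj hRx using hRex
  have hR : ∀ j, 0 ≤ R j := fun j => (Nat.cast_nonneg j).trans (hRj j)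
  have hk4 : ∀ j, 0 ≤ 4 * k j := fun j => by linarith [hk j]
  obtain ⟨θ, hθ0, hθ⟩ := ds_ode k hk (fun j x => 4 * k j * dsB (R j) x) (fun j => 4 * k j)
    (fun j x => by
      rw [abs_of_nonneg (mul_nonneg (hk4 j) (dsB_nonneg _ _))]
      refine mul_le_of_le_one_right (hk4 j) ((dsB_le (hR j) x).trans ?_)
      rw [div_le_one (by positivity)]
      linarith [abs_nonneg x])
    (fun j => continuous_const.mul (dsB_cont _))
    (fun j x hx => by rw [dsB_zero (hx.trans (hRj j)), mul_zero])
  set V : ℝ → ℝ := fun x =>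
    -∑ l ∈ Finset.range (⌈x⌉₊ + 1), 4 * k l * dsB (R l) x * sin (2 * θ l x) with hVdef
  have hVs : ∀ (N : ℕ) (x : ℝ), x < N →
      V x = -∑ l ∈ Finset.range N, 4 * k l * dsB (R l) x * sin (2 * θ l x) := by
    have aux : ∀ (N M : ℕ), N ≤ M → ∀ x : ℝ, x < N →
        ∑ l ∈ Finset.range N, 4 * k l * dsB (R l) x * sin (2 * θ l x)
        = ∑ l ∈ Finset.range M, 4 * k l * dsB (R l) x * sin (2 * θ l x) := by
      intro N M hNM x hx
      apply Finset.sum_subset (Finset.range_mono hNM)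
      intro l _ hl
      simp only [Finset.mem_range, not_lt] at hl
      have : (N:ℝ) ≤ l := by exact_mod_cast hl
      rw [dsB_zero (by linarith [hRj l])]; simp
    intro N x hx
    have hx' : x < ((⌈x⌉₊ + 1 : ℕ) : ℝ) := by
      push_cast; linarith [Nat.le_ceil x]
    simp only [hVdef]
    congr 1
    rcases le_total N (⌈x⌉₊ + 1) with h' | h'
    · exact (aux _ _ h' x hx).symm
    · exact aux _ _ h' x hx'
  have hθ' : ∀ j x, HasDerivAt (θ j) (k j - V x * sin (θ j x) ^ 2 / k j) x := by
    intro j x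
    obtain ⟨N, hN⟩ := exists_nat_gt x
    refine (hθ j N x hN).congr_deriv ?_
    rw [hVs N x hN]; ring
  have hθc : ∀ j, Continuous (θ j) := fun j =>
    continuous_iff_continuousAt.2 fun x => (hθ' j x).continuousAt
  have hVc : Continuous V := by
    rw [continuous_iff_continuousAt]
    intro x
    obtain ⟨N, hN⟩ := exists_nat_gt x
    have hc : Continuous fun y => -∑ l ∈ Finset.range N, 4 * k l * dsB (R l) y * sin (2 * θ l y) := by
      have := fun l => dsB_cont (R l)
      fun_prop
    refine hc.continuousAt.congr ?_
    filter_upwards [eventually_lt_nhds hN] with y hy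
    exact (hVs N y hy).symm
  have hVb : ∀ x b : ℝ, 0 ≤ x → 0 ≤ b →
      (∀ J, R J < x → ∑ l ∈ Finset.range (J + 1), 4 * k l ≤ b) → |V x| ≤ b / (1 + x) := by
    intro x b hx hb hJ
    have h1 := ds_active (fun l => 4 * k l) R x b hk4 hb hJ (⌈x⌉₊ + 1)
    have h0 : 0 < 1 + x := by linarith
    calc |V x| ≤ ∑ l ∈ Finset.range (⌈x⌉₊ + 1), (if R l < x then 4 * k l else 0) / (1 + x) := by
          simp only [hVdef]
          rw [abs_neg]
          refine (Finset.abs_sum_le_sum_abs _ _).trans (Finset.sum_le_sum fun l _ => ?_)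
          rw [abs_mul, abs_of_nonneg (mul_nonneg (hk4 l) (dsB_nonneg _ _))]
          refine (mul_le_of_le_one_right (mul_nonneg (hk4 l) (dsB_nonneg _ _))
            (abs_sin_le_one _)).trans ?_
          split_ifs with hl
          · rw [div_eq_mul_one_div]
            refine mul_le_mul_of_nonneg_left ?_ (hk4 l)
            have := dsB_le (hR l) x
            rwa [abs_of_nonneg hx] at this
          · rw [dsB_zero (not_lt.1 hl)]; simp
      _ ≤ b / (1 + x) := by
          rw [← Finset.sum_div]
          gcongr
  refine ⟨V, hVc.continuousOn, fun x hx => hVb x (h x) hx (hpos x hx).le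
    fun J hJ => (hRx J x hJ.le).1, ?_⟩
  have hVS : ∀ x, 0 < x → |V x| ≤ dsS x / (1 + x) := fun x hx =>
    hVb x (dsS x) hx.le (by linarith [dsS_one hx.le]) fun J hJ => (hRx J x hJ.le).2.1
  have hAn := dsA_nonneg k hk
  set D : ℕ → ℝ := fun i => 1 + ∑ l ∈ Finset.range (i + 1), dsA k i l with hDdef
  have hD1 : ∀ i, 1 ≤ D i := fun i => by
    simp only [hDdef]
    linarith [Finset.sum_nonneg fun l (_ : l ∈ Finset.range (i + 1)) => hAn i l]
  have hD : ∀ (i N : ℕ) (x : ℝ), 0 ≤ x →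
      ∑ j ∈ Finset.range N, (if R j < x then dsA k i j else 0) ≤ D i * dsS x := by
    intro i N x hx
    have hs := dsS_one hx
    refine ds_active (dsA k i) R x _ (hAn i) (by nlinarith [hD1 i]) (fun J hJ => ?_) N
    rcases le_total i J with hij | hij
    · have h1 := (hRx J x hJ.le).2.2
      have h2 := Finset.single_le_sum
        (f := fun i => ∑ l ∈ Finset.range (J + 1), dsA k i l) (s := Finset.range (J + 1))
        (fun i _ => Finset.sum_nonneg fun l _ => hAn i l)
        (Finset.mem_range.2 (Nat.lt_succ_of_le hij))
      nlinarith [hD1 i]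
    · have h2 : ∑ l ∈ Finset.range (J + 1), dsA k i l ≤ ∑ l ∈ Finset.range (i + 1), dsA k i l :=
        Finset.sum_le_sum_of_subset_of_nonneg (Finset.range_mono (by omega))
          fun l _ _ => hAn i l
      have h3 : ∑ l ∈ Finset.range (J + 1), dsA k i l ≤ D i := by
        simp only [hDdef]; linarith
      nlinarith [hD1 i]
  refine hdense.trans (closure_mono ?_)
  rintro _ ⟨i, rfl⟩
  have hi := hk i
  refine ⟨by positivity, ?_⟩
  set f : ℝ → ℝ := fun x => V x * sin (2 * θ i x) / (2 * k i) with hf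
  have hfc : Continuous f := by
    have := hθc i
    fun_prop
  set P : ℝ → ℝ := fun x => ∫ t in (0:ℝ)..x, f t with hPdef
  have hP : ∀ x, HasDerivAt P (V x * sin (2 * θ i x) / (2 * k i)) x := fun x =>
    intervalIntegral.integral_hasDerivAt_right (hfc.intervalIntegrable _ _)
      (hfc.stronglyMeasurableAtFilter _ _) hfc.continuousAt
  have hP0 : P 0 = 0 := by simp [hPdef]
  have hPc : Continuous P := continuous_iff_continuousAt.2 fun x => (hP x).continuousAt
  obtain ⟨C, hC⟩ := ds_decay k R D θ V P hk hinj hR hθ' hVs hVS hD i hP0 hP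
  have hu1 : ∀ x, HasDerivAt (fun x => exp (P x) * sin (θ i x))
      (k i * (exp (P x) * cos (θ i x))) x := by
    intro x
    refine ((hP x).exp.fun_mul (hθ' i x).sin).congr_deriv ?_
    rw [sin_two_mul]
    field_simp
    ring
  have hu2 : ∀ x, HasDerivAt (fun x => k i * (exp (P x) * cos (θ i x)))
      ((V x - k i ^ 2) * (exp (P x) * sin (θ i x))) x := by
    intro x
    refine (((hP x).exp.fun_mul (hθ' i x).cos).const_mul (k i)).congr_deriv ?_
    rw [sin_two_mul]
    have := sin_sq_add_cos_sq (θ i x)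
    have h2 : cos (θ i x) ^ 2 = 1 - sin (θ i x) ^ 2 := by linarith
    field_simp
    linear_combination (V x * sin (θ i x)) * h2
  have hθi := hθc i
  refine ⟨_, _, _, fun x _ => hu1 x, fun x _ => hu2 x, ?_, fun x _ => by ring, ?_, ?_, ?_⟩
  · apply Continuous.continuousOn
    fun_prop
  · simp [hθ0]
  · by_contra hcon
    push Not at hcon
    -- derivative from the right at zero would vanish
    have h1 := (hu1 0).hasDerivWithinAt (s := Ici 0)
    have h2 : HasDerivWithinAt (fun x => exp (P x) * sin (θ i x)) 0 (Ici 0) 0 :=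
      (hasDerivWithinAt_const (0:ℝ) (Ici 0) (0:ℝ)).congr (fun x hx => hcon x hx)
        (hcon 0 self_mem_Ici)
    have h3 := (uniqueDiffWithinAt_Ici (0:ℝ)).eq_deriv _ h1 h2
    simp only [hP0, hθ0, exp_zero, cos_zero, mul_one] at h3
    linarith
  · have hint : IntegrableOn (fun x : ℝ => exp (2 * C) * (1 + x ^ 2)⁻¹) (Ici 0) :=
      (integrable_inv_one_add_sq.const_mul _).integrableOn
    refine Integrable.mono' hint ?_ ?_
    · exact Continuous.aestronglyMeasurable (by fun_prop)
    · refine (ae_restrict_iff' measurableSet_Ici).2 (Filter.Eventually.of_forall fun x hx => ?_)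
      have hx0 : 0 ≤ x := hx
      have h1x : 0 < 1 + x := by linarith
      rw [Real.norm_eq_abs, abs_of_nonneg (sq_nonneg _), mul_pow]
      have e1 : exp (P x) ≤ exp C / (1 + x) := by
        calc exp (P x) ≤ exp (C - log (1 + x)) := exp_le_exp.2 (hC x hx0)
          _ = _ := by rw [exp_sub, exp_log h1x]
      have e2 : exp (P x) ^ 2 ≤ (exp C / (1 + x)) ^ 2 := by gcongr
      have e3 : (exp C / (1 + x)) ^ 2 ≤ exp (2 * C) * (1 + x ^ 2)⁻¹ := by
        rw [div_pow, ← exp_nat_mul, div_eq_mul_inv]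
        push_cast
        gcongr
        nlinarith
      exact (mul_le_of_le_one_right (by positivity) (sin_sq_le_one _)).trans (e2.trans e3)
end

section
/- Let V : [0,∞) → ℝ be continuous and suppose there is a constant C with |V(x)| ≤ C/(1+x) for all x ≥ 0. Let S be the set of energies E ∈ (0,∞) for which the eigenfunction equation −u'' + V u = E u admits a nonzero twice continuously differentiable solution u on [0,∞) with u(0) = 0 and ∫₀^∞ |u(x)|² dx < ∞. Then S is countable and the sum of its elements is finite: ∑_{E ∈ S} E < ∞. -/
open Real Set MeasureTheory

lemma mono_aux {F F' : ℝ → ℝ} {a : ℝ} (h : ∀ x, a ≤ x → HasDerivAt F (F' x) x)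
    (h0 : ∀ x, a ≤ x → 0 ≤ F' x) : ∀ x y, a ≤ x → x ≤ y → F x ≤ F y := by
  have hm : MonotoneOn F (Ici a) := by
    apply monotoneOn_of_hasDerivWithinAt_nonneg (f' := F') (convex_Ici a)
    · intro x hx
      exact (h x hx).continuousAt.continuousWithinAt
    · intro x hx
      rw [interior_Ici] at hx
      exact (h x (le_of_lt hx)).hasDerivWithinAt
    · intro x hx
      rw [interior_Ici] at hx
      exact h0 x (le_of_lt hx)
  intro x y hx hxy
  exact hm hx (le_trans hx hxy) hxy

lemma pos_aux {P P' : ℝ → ℝ} {K : ℝ} (h : ∀ x, 0 ≤ x → HasDerivAt P (P' x) x)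
    (hK : ∀ x, 0 ≤ x → |P' x| ≤ K * P x) {x1 : ℝ} (hx1 : 0 ≤ x1) (hp : 0 < P x1) :
    ∀ x, 0 ≤ x → 0 < P x := by
  have e : ∀ c x : ℝ, HasDerivAt (fun x : ℝ => exp (c * x)) (exp (c * x) * c) x := by
    intro c x
    have := ((hasDerivAt_id x).const_mul c).exp
    simpa using this
  have h1 := mono_aux (a := 0) (fun x hx => (h x hx).mul (e K x)) (by
    intro x hx
    have := (abs_le.1 (hK x hx)).1
    have h3 := exp_pos (K * x)
    nlinarith)
  have h2 := mono_aux (a := 0) (fun x hx => ((h x hx).mul (e (-K) x)).neg) (by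
    intro x hx
    have := (abs_le.1 (hK x hx)).2
    have h3 := exp_pos (-K * x)
    nlinarith)
  intro x hx
  rcases le_total x x1 with hl | hl
  · have := h2 x x1 hx hl
    simp only [Pi.neg_apply, Pi.mul_apply, neg_le_neg_iff] at this
    have h3 := mul_pos hp (exp_pos (-K * x1))
    exact pos_of_mul_pos_left (lt_of_lt_of_le h3 this) (exp_pos _).le
  · have := h1 x1 x hx1 hl
    simp only [Pi.mul_apply] at this
    have h3 := mul_pos hp (exp_pos (K * x1))
    exact pos_of_mul_pos_left (lt_of_lt_of_le h3 this) (exp_pos _).le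

lemma single_aux (V : ℝ → ℝ) (C : ℝ) (hbd : ∀ x ∈ Ici (0 : ℝ), |V x| ≤ C / (1 + x))
    (k : ℝ) (hk : 0 < k) (hE : IsDirichletEigenvalue V (k ^ 2)) :
    ∃ u u' S c w : ℝ → ℝ, 
      (∀ x, 0 ≤ x → HasDerivAt u (u' x) x) ∧
      (∀ x, 0 ≤ x → HasDerivAt u' ((V x - k ^ 2) * u x) x) ∧
      IntegrableOn (fun x => u x ^ 2) (Ici (0 : ℝ)) ∧
      (∀ x, 0 ≤ x → 0 < k ^ 2 * u x ^ 2 + u' x ^ 2) ∧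
      (∀ x, 0 ≤ x → HasDerivAt (fun x => log (k ^ 2 * u x ^ 2 + u' x ^ 2)) (V x * S x / k) x) ∧
      (∀ x, 0 ≤ x → HasDerivAt S (2 * (k - w x) * c x) x) ∧
      (∀ x, 0 ≤ x → HasDerivAt c (-(2 * (k - w x) * S x)) x) ∧
      (∀ x, 0 ≤ x → |S x| ≤ 1) ∧ (∀ x, 0 ≤ x → |c x| ≤ 1) ∧
      (∀ x, 0 ≤ x → |w x| ≤ C / k / (1 + x)) := by
  obtain ⟨u, u', u'', h1, h2, -, h3, -, ⟨x1, hx1, hne⟩, hint⟩ := hE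
  have h2' : ∀ x, 0 ≤ x → HasDerivAt u' ((V x - k ^ 2) * u x) x := by
    intro x hx
    convert h2 x hx using 1
    linarith [h3 x hx]
  have hP : ∀ x, 0 ≤ x → HasDerivAt (fun x => k ^ 2 * u x ^ 2 + u' x ^ 2)
      (2 * V x * u x * u' x) x := by
    intro x hx
    refine ((((h1 x hx).pow 2).const_mul (k ^ 2)).add ((h2' x hx).pow 2)).congr_deriv ?_
    push_cast
    ring
  have hC : 0 ≤ C := by
    have := hbd 0 (by simp)
    have h := abs_nonneg (V 0)
    norm_num at this
    linarith
  have hVC : ∀ x, 0 ≤ x → |V x| ≤ C := by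
    intro x hx
    exact (hbd x hx).trans (div_le_self hC (by linarith))
  have hpos : ∀ x, 0 ≤ x → 0 < k ^ 2 * u x ^ 2 + u' x ^ 2 := by
    apply pos_aux (K := C / k) hP _ (x1 := x1) hx1 (by positivity)
    intro x hx
    have a1 : |2 * V x * u x * u' x| = |V x| * (2 * |k * u x| * |u' x|) / k := by
      simp only [abs_mul, abs_of_pos hk]
      field_simp
      simp
      try ring
    rw [a1]
    have a2 : 2 * |k * u x| * |u' x| ≤ k ^ 2 * u x ^ 2 + u' x ^ 2 := by
      have := two_mul_le_add_sq |k * u x| |u' x|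
      rw [sq_abs, sq_abs] at this
      linarith
    rw [div_mul_eq_mul_div]
    have := hVC x hx
    gcongr
  refine ⟨u, u', fun x => 2 * k * u x * u' x / (k ^ 2 * u x ^ 2 + u' x ^ 2), 
    fun x => (u' x ^ 2 - k ^ 2 * u x ^ 2) / (k ^ 2 * u x ^ 2 + u' x ^ 2), 
    fun x => V x * k * u x ^ 2 / (k ^ 2 * u x ^ 2 + u' x ^ 2), h1, h2', hint, hpos, 
    ?_, ?_, ?_, ?_, ?_, ?_⟩
  · intro x hx
    have hp := (hpos x hx).ne'
    convert (hP x hx).log hp using 1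
    field_simp
  · intro x hx
    have hp := (hpos x hx).ne'
    refine ((((h1 x hx).const_mul (2 * k)).mul (h2' x hx)).div (hP x hx) hp).congr_deriv ?_
    try simp only [Pi.mul_apply, Pi.pow_apply, Pi.sub_apply, Pi.add_apply]
    field_simp
    ring
  · intro x hx
    have hp := (hpos x hx).ne'
    refine ((((h2' x hx).pow 2).sub (((h1 x hx).pow 2).const_mul (k ^ 2))).div
      (hP x hx) hp).congr_deriv ?_
    try simp only [Pi.mul_apply, Pi.pow_apply, Pi.sub_apply, Pi.add_apply]
    field_simp
    ring
  · intro x hx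
    have hp := (hpos x hx)
    rw [abs_div, abs_of_pos hp, div_le_one hp, abs_le]
    constructor
    · nlinarith [sq_nonneg (k * u x + u' x)]
    · nlinarith [sq_nonneg (k * u x - u' x)]
  · intro x hx
    have hp := (hpos x hx)
    rw [abs_div, abs_of_pos hp, div_le_one hp, abs_le]
    constructor
    · nlinarith [sq_nonneg (u' x)]
    · nlinarith [sq_nonneg (k * u x)]
  · intro x hx
    have hp := (hpos x hx)
    have e : V x * k * u x ^ 2 / (k ^ 2 * u x ^ 2 + u' x ^ 2)
        = (V x / k) * (k ^ 2 * u x ^ 2 / (k ^ 2 * u x ^ 2 + u' x ^ 2)) := by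
      field_simp
    have e2 : k ^ 2 * u x ^ 2 / (k ^ 2 * u x ^ 2 + u' x ^ 2) ≤ 1 := by
      rw [div_le_one hp]
      nlinarith [sq_nonneg (u' x)]
    have e3 : 0 ≤ k ^ 2 * u x ^ 2 / (k ^ 2 * u x ^ 2 + u' x ^ 2) := by positivity
    change |V x * k * u x ^ 2 / (k ^ 2 * u x ^ 2 + u' x ^ 2)| ≤ _
    rw [e, abs_mul, abs_of_nonneg e3, abs_div, abs_of_pos hk]
    have e4 : |V x| / k ≤ C / k / (1 + x) := by
      rw [div_right_comm]
      have := hbd x hx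
      gcongr
    exact (mul_le_of_le_one_right (by positivity) e2).trans e4

lemma inv_deriv (x : ℝ) (hx : 0 ≤ x) :
    HasDerivAt (fun x : ℝ => (1 + x)⁻¹) (-((1 + x)⁻¹ ^ 2)) x := by
  have h := ((hasDerivAt_id x).const_add 1).inv (by simp; linarith)
  refine h.congr_deriv ?_
  simp [neg_div]

lemma log_deriv (x : ℝ) (hx : 0 ≤ x) :
    HasDerivAt (fun x : ℝ => log (1 + x)) ((1 + x)⁻¹) x := by
  have h := ((hasDerivAt_id x).const_add 1).log (by simp; linarith)
  refine h.congr_deriv ?_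
  simp

lemma abs_mul_le_one {a b : ℝ} (ha : |a| ≤ 1) (hb : |b| ≤ 1) : |a * b| ≤ 1 := by
  rw [abs_mul]
  exact mul_le_one₀ ha (abs_nonneg _) hb

lemma pair_aux (C k l : ℝ) (hk : 0 < k) (hl : 0 < l) (hkl : k ≠ l)
    (S c w T d z : ℝ → ℝ)
    (hS : ∀ x, 0 ≤ x → HasDerivAt S (2 * (k - w x) * c x) x)
    (hc : ∀ x, 0 ≤ x → HasDerivAt c (-(2 * (k - w x) * S x)) x)
    (hS1 : ∀ x, 0 ≤ x → |S x| ≤ 1) (hc1 : ∀ x, 0 ≤ x → |c x| ≤ 1)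
    (hw : ∀ x, 0 ≤ x → |w x| ≤ C / k / (1 + x))
    (hT : ∀ x, 0 ≤ x → HasDerivAt T (2 * (l - z x) * d x) x)
    (hd : ∀ x, 0 ≤ x → HasDerivAt d (-(2 * (l - z x) * T x)) x)
    (hT1 : ∀ x, 0 ≤ x → |T x| ≤ 1) (hd1 : ∀ x, 0 ≤ x → |d x| ≤ 1)
    (hz : ∀ x, 0 ≤ x → |z x| ≤ C / l / (1 + x)) :
    ∃ G G' : ℝ → ℝ, ∃ M : ℝ, (∀ x, 0 ≤ x → G x ≤ M) ∧
      (∀ x, 0 ≤ x → HasDerivAt G (G' x) x) ∧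
      (∀ x, 0 ≤ x → k * l * (S x * T x) * (1 + x)⁻¹ ≤ G' x) := by
  have hD : k ^ 2 - l ^ 2 ≠ 0 := by
    intro h
    have : (k - l) * (k + l) = 0 := by linarith
    rcases mul_eq_zero.1 this with h | h
    · exact hkl (by linarith)
    · linarith
  set q : ℝ := k * l / (2 * (k ^ 2 - l ^ 2)) with hq
  set N : ℝ := 2 * (l + k) * (C / k + C / l) + (l + k) with hN
  let W : ℝ → ℝ := fun x => l * (S x * d x) - k * (c x * T x)
  have hW : ∀ x, 0 ≤ x → |W x| ≤ l + k := by
    intro x hx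
    have a1 := abs_le.1 (abs_mul_le_one (hS1 x hx) (hd1 x hx))
    have a2 := abs_le.1 (abs_mul_le_one (hc1 x hx) (hT1 x hx))
    rw [abs_le]
    constructor <;> simp only [W] <;> nlinarith
  have hN0 : 0 ≤ N := by
    have a := (abs_nonneg _).trans (hw 0 le_rfl)
    have b := (abs_nonneg _).trans (hz 0 le_rfl)
    norm_num at a b
    positivity
  have hWd : ∀ x, 0 ≤ x → HasDerivAt W (2 * (k ^ 2 - l ^ 2) * (S x * T x)
      + (l * (-2 * w x * (c x * d x) + 2 * z x * (S x * T x))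
        - k * (2 * w x * (S x * T x) - 2 * z x * (c x * d x)))) x := by
    intro x hx
    refine ((((hS x hx).mul (hd x hx)).const_mul l).sub
      (((hc x hx).mul (hT x hx)).const_mul k)).congr_deriv ?_
    ring
  refine ⟨fun x => q * (W x * (1 + x)⁻¹) - |q| * N * (1 + x)⁻¹, _, |q| * (l + k), ?_, 
    fun x hx => (((hWd x hx).mul (inv_deriv x hx)).const_mul q).sub
      ((inv_deriv x hx).const_mul (|q| * N)), ?_⟩
  · intro x hx
    have h1 : (1 + x)⁻¹ ≤ 1 := inv_le_one_of_one_le₀ (by linarith)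
    have h0 : 0 ≤ (1 + x)⁻¹ := by positivity
    have h2 : q * (W x * (1 + x)⁻¹) ≤ |q| * (l + k) := by
      apply (le_abs_self _).trans
      rw [abs_mul, abs_mul, abs_of_nonneg h0]
      have := hW x hx
      have h3 : |W x| * (1 + x)⁻¹ ≤ (l + k) * 1 := by gcongr
      rw [mul_one] at h3
      gcongr
    have : 0 ≤ |q| * N * (1 + x)⁻¹ := by positivity
    linarith
  · intro x hx
    have h0 : 0 ≤ (1 + x)⁻¹ := by positivity
    set y := (1 + x)⁻¹ with hy
    have a1 := abs_mul_le_one (hS1 x hx) (hT1 x hx)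
    have a2 := abs_mul_le_one (hc1 x hx) (hd1 x hx)
    have b1 := hw x hx
    have b2 := hz x hx
    rw [div_eq_mul_inv _ (1 + x), ← hy] at b1 b2
    set r := (l * (-2 * w x * (c x * d x) + 2 * z x * (S x * T x))
        - k * (2 * w x * (S x * T x) - 2 * z x * (c x * d x))) with hr
    have m : ∀ a b B : ℝ, |a| ≤ B → |b| ≤ 1 → |a * b| ≤ B := by
      intro a b B h1 h2
      rw [abs_mul]
      exact (mul_le_of_le_one_right (abs_nonneg _) h2).trans h1
    have c1 := abs_le.1 (m _ _ _ b1 a1)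
    have c2 := abs_le.1 (m _ _ _ b1 a2)
    have c3 := abs_le.1 (m _ _ _ b2 a1)
    have c4 := abs_le.1 (m _ _ _ b2 a2)
    have hr1 : |r| ≤ 2 * (l + k) * (C / k + C / l) * y := by
      have e : r = 2 * (l * (z x * (S x * T x) - w x * (c x * d x))
        + k * (z x * (c x * d x) - w x * (S x * T x))) := by rw [hr]; ring
      have d1 : |z x * (S x * T x) - w x * (c x * d x)| ≤ (C / k + C / l) * y := by
        rw [abs_le]; constructor <;> linarith
      have d2 : |z x * (c x * d x) - w x * (S x * T x)| ≤ (C / k + C / l) * y := by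
        rw [abs_le]; constructor <;> linarith
      rw [abs_le] at d1 d2
      rw [e, abs_le]
      constructor <;> nlinarith
    have hrr : |q * (r * y - W x * y ^ 2)| ≤ |q| * N * y ^ 2 := by
      rw [abs_mul, mul_assoc]
      apply mul_le_mul_of_nonneg_left _ (abs_nonneg _)
      apply (abs_sub _ _).trans
      rw [abs_mul, abs_mul, abs_of_nonneg h0, abs_of_nonneg (sq_nonneg y)]
      have e1 := mul_le_mul_of_nonneg_right hr1 h0
      have e2 := mul_le_mul_of_nonneg_right (hW x hx) (sq_nonneg y)
      rw [hN]
      nlinarith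
    have hqq : q * (2 * (k ^ 2 - l ^ 2) * (S x * T x)) = k * l * (S x * T x) := by
      rw [hq]; field_simp
    have := (abs_le.1 hrr).1
    rw [← hqq]
    linarith

lemma small_aux {ι : Type*} (s : Finset ι) (V : ℝ → ℝ) (C : ℝ)
    (hVC : ∀ x, 0 ≤ x → |V x| ≤ C) (k : ι → ℝ) (u u' : ι → ℝ → ℝ)
    (h1 : ∀ i ∈ s, ∀ x, 0 ≤ x → HasDerivAt (u i) (u' i x) x)
    (h2 : ∀ i ∈ s, ∀ x, 0 ≤ x → HasDerivAt (u' i) ((V x - k i ^ 2) * u i x) x)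
    (hi : ∀ i ∈ s, IntegrableOn (fun x => u i x ^ 2) (Ici (0 : ℝ))) (X : ℝ) :
    ∃ x, X ≤ x ∧ 0 ≤ x ∧ ∀ i ∈ s, k i ^ 2 * u i x ^ 2 + u' i x ^ 2 ≤ (1 + x)⁻¹ := by
  by_contra! hcon
  set Y := max X 1 with hY
  have hY1 : 1 ≤ Y := le_max_right _ _
  have hYX : X ≤ Y := le_max_left _ _
  -- sum version
  have hsum : ∀ x, Y ≤ x → (1 + x)⁻¹ ≤ ∑ i ∈ s, (k i ^ 2 * u i x ^ 2 + u' i x ^ 2) := by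
    intro x hx
    obtain ⟨i, his, h⟩ := hcon x (by linarith) (by linarith)
    exact h.le.trans (Finset.single_le_sum
      (f := fun i => k i ^ 2 * u i x ^ 2 + u' i x ^ 2) (fun i _ => by positivity) his)
  let H : ι → ℝ → ℝ := fun i x => ∫ t in (0 : ℝ)..x, u i t ^ 2
  have hcont : ∀ i ∈ s, ContinuousOn (fun x => u i x ^ 2) (Ici 0) := by
    intro i his x hx
    exact ((h1 i his x hx).continuousAt.pow 2).continuousWithinAt
  have hH : ∀ i ∈ s, ∀ x, Y ≤ x → HasDerivAt (H i) (u i x ^ 2) x := by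
    intro i his x hx
    have hx0 : 0 < x := by linarith
    apply intervalIntegral.integral_hasDerivAt_right
    · apply ContinuousOn.intervalIntegrable
      apply (hcont i his).mono
      rw [uIcc_of_le hx0.le]
      exact Icc_subset_Ici_self
    · exact ((hcont i his).mono Ioi_subset_Ici_self).stronglyMeasurableAtFilter isOpen_Ioi x hx0
    · exact ((h1 i his x hx0.le).continuousAt.pow 2)
  have hHb : ∀ i ∈ s, ∀ x, Y ≤ x → H i x ≤ ∫ t in Ici (0 : ℝ), u i t ^ 2 := by
    intro i his x hx
    have hx0 : 0 ≤ x := by linarith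
    simp only [H]
    rw [intervalIntegral.integral_of_le hx0]
    apply setIntegral_mono_set (hi i his)
    · exact Filter.Eventually.of_forall (fun x => sq_nonneg _)
    · exact (Ioc_subset_Ioi_self.trans Ioi_subset_Ici_self).eventuallyLE
  set A : ι → ℝ := fun i => 2 * k i ^ 2 + C
  set B : ι → ℝ := fun i => ∫ t in Ici (0 : ℝ), u i t ^ 2
  have hC0 : 0 ≤ C := (abs_nonneg _).trans (hVC 0 le_rfl)
  -- step 1
  have m1 := mono_aux (a := Y) (F := fun x => ∑ i ∈ s, (u i x * u' i x + A i * H i x) - log (1 + x))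
    (fun x hx => (HasDerivAt.fun_sum (u := s) (fun i his =>
      ((h1 i his x (by linarith)).mul (h2 i his x (by linarith))).add
        ((hH i his x hx).const_mul (A i)))).sub (log_deriv x (by linarith))) (by
    intro x hx
    have := hsum x hx
    have h3 : ∑ i ∈ s, (k i ^ 2 * u i x ^ 2 + u' i x ^ 2) ≤ ∑ i ∈ s,
        (u' i x * u' i x + u i x * ((V x - k i ^ 2) * u i x) + A i * u i x ^ 2) := by
      apply Finset.sum_le_sum
      intro i his
      have := (abs_le.1 (hVC x (by linarith))).1
      simp only [A]
      nlinarith [mul_nonneg (sq_nonneg (u i x)) (by linarith : 0 ≤ V x + C)]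
    linarith)
  set D := (∑ i ∈ s, (u i Y * u' i Y + A i * H i Y) - log (1 + Y)) with hD
  have m1' : ∀ x, Y ≤ x → log (1 + x) + D - ∑ i ∈ s, A i * B i ≤ ∑ i ∈ s, u i x * u' i x := by
    intro x hx
    have h3 := m1 Y x le_rfl hx
    rw [← hD, Finset.sum_add_distrib] at h3
    have h4 : ∑ i ∈ s, A i * H i x ≤ ∑ i ∈ s, A i * B i := by
      apply Finset.sum_le_sum
      intro i his
      apply mul_le_mul_of_nonneg_left (hHb i his x hx)
      simp only [A]; positivity
    linarith
  obtain ⟨Z, hZY, hZ⟩ : ∃ Z, Y ≤ Z ∧ ∀ x, Z ≤ x → 1 ≤ ∑ i ∈ s, u i x * u' i x := by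
    refine ⟨max Y (exp (1 - D + ∑ i ∈ s, A i * B i)), le_max_left _ _, fun x hx => ?_⟩
    have h3 := m1' x ((le_max_left _ _).trans hx)
    have h4 : exp (1 - D + ∑ i ∈ s, A i * B i) ≤ 1 + x := by
      have := (le_max_right _ _).trans hx
      linarith
    have h5 := (le_log_iff_exp_le (by linarith [exp_pos (1 - D + ∑ i ∈ s, A i * B i)])).2 h4
    linarith
  -- step 2
  have m2 := mono_aux (a := Z) (F := fun x => ∑ i ∈ s, u i x ^ 2 - x)
    (fun x hx => (HasDerivAt.fun_sum (u := s) (fun i his =>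
      ((h1 i his x (by linarith)).pow 2))).sub (hasDerivAt_id x)) (by
    intro x hx
    have h3 := hZ x hx
    have h4 : ∑ i ∈ s, (((2 : ℕ) : ℝ) * u i x ^ (2 - 1) * u' i x)
        = 2 * ∑ i ∈ s, u i x * u' i x := by
      rw [Finset.mul_sum]
      apply Finset.sum_congr rfl
      intro i _
      push_cast
      ring
    rw [h4]
    linarith)
  have m2' : ∀ x, Z + 1 ≤ x → 1 ≤ ∑ i ∈ s, u i x ^ 2 := by
    intro x hx
    have h3 := m2 Z x le_rfl (by linarith)
    have h4 : 0 ≤ ∑ i ∈ s, u i Z ^ 2 := Finset.sum_nonneg (fun i _ => sq_nonneg _)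
    linarith
  -- step 3
  have m3 := mono_aux (a := Z + 1) (F := fun x => ∑ i ∈ s, H i x - x)
    (fun x hx => (HasDerivAt.fun_sum (u := s) (fun i his =>
      (hH i his x (by linarith)))).sub (hasDerivAt_id x)) (by
    intro x hx
    have h3 := m2' x hx
    linarith)
  have hb : ∀ x, Y ≤ x → ∑ i ∈ s, H i x ≤ ∑ i ∈ s, B i := fun x hx =>
    Finset.sum_le_sum (fun i his => hHb i his x hx)
  have h0 : 0 ≤ ∑ i ∈ s, H i (Z + 1) := Finset.sum_nonneg (fun i _ =>
    intervalIntegral.integral_nonneg (by linarith) (fun _ _ => sq_nonneg _))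
  have hB0 := h0.trans (hb (Z + 1) (by linarith))
  have h3 := m3 (Z + 1) (Z + 2 + ∑ i ∈ s, B i) le_rfl (by linarith)
  have h4 := hb (Z + 2 + ∑ i ∈ s, B i) (by linarith)
  linarith

lemma finite_bound (V : ℝ → ℝ) (C : ℝ) (hbd : ∀ x ∈ Ici (0 : ℝ), |V x| ≤ C / (1 + x))
    (s : Finset ℝ) (hs : ∀ k ∈ s, 0 < k ∧ IsDirichletEigenvalue V (k ^ 2)) :
    ∑ k ∈ s, k ^ 2 ≤ C ^ 2 := by
  classical
  have hC : 0 ≤ C := by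
    have := hbd 0 (by simp)
    have h := abs_nonneg (V 0)
    norm_num at this
    linarith
  have hVC : ∀ x, 0 ≤ x → |V x| ≤ C := by
    intro x hx
    exact (hbd x hx).trans (div_le_self hC (by linarith))
  have key := fun k : s => single_aux V C hbd k.1 (hs k.1 k.2).1 (hs k.1 k.2).2
  choose u u' S c w h1 h2 hint hpos hlog hS hc hS1 hc1 hw using key
  have pair : ∀ i j : s, ∃ G G' : ℝ → ℝ, ∃ M : ℝ,
      (∀ x, 0 ≤ x → G x ≤ M + (if i = j then (i : ℝ) ^ 2 else 0) * log (1 + x)) ∧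
      (∀ x, 0 ≤ x → HasDerivAt G (G' x) x) ∧
      (∀ x, 0 ≤ x → (i : ℝ) * j * (S i x * S j x) * (1 + x)⁻¹ ≤ G' x) := by
    intro i j
    by_cases hij : i = j
    · subst hij
      refine ⟨fun x => (i : ℝ) ^ 2 * log (1 + x), fun x => (i : ℝ) ^ 2 * (1 + x)⁻¹, 0, ?_,
        fun x hx => (log_deriv x hx).const_mul _, ?_⟩
      · intro x hx
        simp
      · intro x hx
        have a := (abs_le.1 (abs_mul_le_one (hS1 i x hx) (hS1 i x hx))).2
        have : (i : ℝ) * i * (S i x * S i x) ≤ (i : ℝ) ^ 2 := by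
          nlinarith [mul_nonneg (sq_nonneg (i : ℝ)) (sub_nonneg.2 a)]
        exact mul_le_mul_of_nonneg_right this (by positivity)
    · obtain ⟨G, G', M, a, b, d⟩ := pair_aux C i j (hs i i.2).1 (hs j j.2).1
        (fun h => hij (Subtype.ext h)) _ _ _ _ _ _ (hS i) (hc i) (hS1 i) (hc1 i) (hw i)
        (hS j) (hc j) (hS1 j) (hc1 j) (hw j)
      refine ⟨G, G', M, ?_, b, d⟩
      simpa [hij] using a
  choose G G' M hG hGd hG' using pair
  have mono := mono_aux (a := 0) (F := fun x => C ^ 2 * log (1 + x)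
      + ∑ i : s, 2 * (i : ℝ) ^ 2 * log ((i : ℝ) ^ 2 * u i x ^ 2 + u' i x ^ 2)
      + ∑ i : s, ∑ j : s, G i j x)
    (fun x hx => (((log_deriv x hx).const_mul (C ^ 2)).add
      (HasDerivAt.fun_sum (u := Finset.univ) (fun i _ =>
        (hlog i x hx).const_mul (2 * (i : ℝ) ^ 2)))).add
      (HasDerivAt.fun_sum (u := Finset.univ) (fun i _ =>
        HasDerivAt.fun_sum (u := Finset.univ) (fun j _ => hGd i j x hx)))) (by
    intro x hx
    have hy : 0 < (1 + x)⁻¹ := by positivity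
    have a1 : ∑ i : s, ∑ j : s, (i : ℝ) * j * (S i x * S j x) * (1 + x)⁻¹
        ≤ ∑ i : s, ∑ j : s, G' i j x :=
      Finset.sum_le_sum (fun i _ => Finset.sum_le_sum (fun j _ => hG' i j x hx))
    have a2 : ∑ i : s, ∑ j : s, (i : ℝ) * j * (S i x * S j x) * (1 + x)⁻¹
        = (∑ i : s, (i : ℝ) * S i x) ^ 2 * (1 + x)⁻¹ := by
      rw [sq, Finset.sum_mul_sum, Finset.sum_mul]
      refine Finset.sum_congr rfl (fun i _ => ?_)
      rw [Finset.sum_mul]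
      refine Finset.sum_congr rfl (fun j _ => ?_)
      ring
    have a3 : ∑ i : s, 2 * (i : ℝ) ^ 2 * (V x * S i x / i) 
        = 2 * V x * ∑ i : s, (i : ℝ) * S i x := by
      rw [Finset.mul_sum]
      refine Finset.sum_congr rfl (fun i _ => ?_)
      have := (hs i i.2).1.ne'
      field_simp
    have a4 : V x ^ 2 * (1 + x) ≤ C ^ 2 * (1 + x)⁻¹ := by
      have h := hbd x hx
      have h' : V x ^ 2 ≤ (C / (1 + x)) ^ 2 := by
        rw [← sq_abs]
        gcongr
      calc V x ^ 2 * (1 + x) ≤ (C / (1 + x)) ^ 2 * (1 + x) := by gcongr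
        _ = _ := by field_simp
    rw [a3]
    rw [a2] at a1
    set Q := ∑ i : s, (i : ℝ) * S i x
    have a5 : V x ^ 2 * (1 + x) + 2 * V x * Q + Q ^ 2 * (1 + x)⁻¹
        = (V x * (1 + x) + Q) ^ 2 * (1 + x)⁻¹ := by
      field_simp
      ring
    have a6 : 0 ≤ (V x * (1 + x) + Q) ^ 2 * (1 + x)⁻¹ := by positivity
    linarith)
  by_contra! hlt
  set Φ0 := _root_.id (C ^ 2 * log (1 + 0)
      + ∑ i : s, 2 * (i : ℝ) ^ 2 * log ((i : ℝ) ^ 2 * u i 0 ^ 2 + u' i 0 ^ 2)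
      + ∑ i : s, ∑ j : s, G i j 0) with hΦ
  set ES := ∑ k ∈ s, k ^ 2 with hES
  have hES' : ∑ i : s, (i : ℝ) ^ 2 = ES := Finset.sum_coe_sort s (fun k => k ^ 2)
  set MM := ∑ i : s, ∑ j : s, M i j
  obtain ⟨x, hXx, hx, hsm⟩ := small_aux (Finset.univ : Finset s) V C hVC (fun i => (i : ℝ)) u u'
    (fun i _ => h1 i) (fun i _ => h2 i) (fun i _ => hint i)
    (exp ((MM - Φ0 + 1) / (ES - C ^ 2)))
  have hm : Φ0 ≤ _ := mono 0 x le_rfl hx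
  have b1 : ∑ i : s, ∑ j : s, G i j x ≤ MM + ES * log (1 + x) := by
    calc _ ≤ ∑ i : s, ∑ j : s, (M i j + (if i = j then (i : ℝ) ^ 2 else 0) * log (1 + x)) :=
          Finset.sum_le_sum (fun i _ => Finset.sum_le_sum (fun j _ => hG i j x hx))
      _ = _ := by
          simp only [Finset.sum_add_distrib, ← Finset.sum_mul]
          simp only [Finset.sum_ite_eq, Finset.mem_univ, if_true]
          rw [hES']
  have b2 : ∑ i : s, 2 * (i : ℝ) ^ 2 * log ((i : ℝ) ^ 2 * u i x ^ 2 + u' i x ^ 2)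
      ≤ - (2 * ES * log (1 + x)) := by
    rw [← hES', Finset.mul_sum, Finset.sum_mul, ← Finset.sum_neg_distrib]
    apply Finset.sum_le_sum
    intro i _
    have := log_le_log (hpos i x hx) (hsm i (Finset.mem_univ _))
    rw [log_inv] at this
    nlinarith [mul_le_mul_of_nonneg_left this (sq_nonneg (i : ℝ))]
  have b3 : (MM - Φ0 + 1) / (ES - C ^ 2) ≤ log (1 + x) := by
    rw [le_log_iff_exp_le (by linarith)]
    linarith
  rw [div_le_iff₀ (by linarith)] at b3
  nlinarith

/-- **Kiselev–Last–Simon.** If `|V(x)| ≤ C/(1+x)` then the set `S` of positive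
Dirichlet eigenvalues of `-d²/dx² + V` is countable with `∑_{E ∈ S} E < ∞`. -/
theorem sum_of_positive_eigenvalues_finite
    (V : ℝ → ℝ) (hVc : ContinuousOn V (Ici (0 : ℝ)))
    (C : ℝ) (hbd : ∀ x ∈ Ici (0 : ℝ), |V x| ≤ C / (1 + x)) :
    {E : ℝ | 0 < E ∧ IsDirichletEigenvalue V E}.Countable ∧
    Summable (fun E : {E : ℝ | 0 < E ∧ IsDirichletEigenvalue V E} => (E : ℝ)) := by
  have hfin : ∀ t : Finset {E : ℝ | 0 < E ∧ IsDirichletEigenvalue V E},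
      ∑ E ∈ t, (E : ℝ) ≤ C ^ 2 := by
    intro t
    classical
    have h := finite_bound V C hbd (t.image (fun E : {E : ℝ | 0 < E ∧ IsDirichletEigenvalue V E} => √(E : ℝ))) (by
      intro k hk
      obtain ⟨E, hE, rfl⟩ := Finset.mem_image.1 hk
      refine ⟨Real.sqrt_pos.2 E.2.1, ?_⟩
      rw [Real.sq_sqrt E.2.1.le]
      exact E.2.2)
    rw [Finset.sum_image] at h
    · calc _ = ∑ E ∈ t, √(E : ℝ) ^ 2 := by
            refine Finset.sum_congr rfl (fun E _ => ?_)
            rw [Real.sq_sqrt E.2.1.le]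
        _ ≤ _ := h
    · intro a _ b _ hab
      exact Subtype.ext ((Real.sqrt_inj a.2.1.le b.2.1.le).1 hab)
  have hsum := summable_of_sum_le (fun E : {E : ℝ | 0 < E ∧ IsDirichletEigenvalue V E} =>
    E.2.1.le) hfin
  refine ⟨?_, hsum⟩
  have hc := hsum.countable_support
  have hu : Function.support (fun E : {E : ℝ | 0 < E ∧ IsDirichletEigenvalue V E} => (E : ℝ))
      = univ := by
    ext E
    simpa using E.2.1.ne'
  rw [hu, countable_univ_iff] at hc
  exact hc
end
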